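/- Two-anyon energy asymptotics: there exist constants C > 0 and α₀ ∈ (0,1] such that for every α ∈ (0, α₀], the two-anyon Neumann energy on the unit square satisfies |E^N_2(α) − 4πα| ≤ C α^{4/3}. -/

import Mathlib

noncomputable section

open MeasureTheory Real Set
open scoped BigOperators Topology

/-- The plane `ℝ²`, with points written as pairs. -/
abbrev Plane : Type := ℝ × ℝ

/-- Configuration space of `N` particles in the plane. -/
abbrev Config (N : ℕ) : Type := Fin N → Plane

/-- `x^{-⊥} := (-y, x)/(x² + y²)` for `x = (x, y) ∈ ℝ²`. -/
def perpInv (v : Plane) : Plane :=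
  (-v.2 / (v.1 ^ 2 + v.2 ^ 2), v.1 / (v.1 ^ 2 + v.2 ^ 2))

/-- The Aharonov–Bohm potential `A_j(x) = ∑_{k ≠ j} (x_j - x_k)^{-⊥}`. -/
def abPot (N : ℕ) (j : Fin N) (x : Config N) : Plane :=
  ∑ k ∈ Finset.univ.erase j, perpInv (x j - x k)

/-- Partial derivative of `Ψ` at `x` in direction `v` of the `j`-th particle. -/
def pder (N : ℕ) (j : Fin N) (v : Plane) (Ψ : Config N → ℂ) (x : Config N) : ℂ :=
  fderiv ℝ Ψ x (Pi.single j v)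

/-- The two components of `D_j Ψ = -i ∇_{x_j} Ψ + α A_j Ψ` at `x`. -/
def DOp (N : ℕ) (α : ℝ) (j : Fin N) (Ψ : Config N → ℂ) (x : Config N) : ℂ × ℂ :=
  (-Complex.I * pder N j (1, 0) Ψ x + Complex.ofReal (α * (abPot N j x).1) * Ψ x,
   -Complex.I * pder N j (0, 1) Ψ x + Complex.ofReal (α * (abPot N j x).2) * Ψ x)

/-- `|D_j Ψ(x)|²`, the squared Euclidean norm of the vector `D_j Ψ(x) ∈ ℂ²`. -/
def DSq (N : ℕ) (α : ℝ) (j : Fin N) (Ψ : Config N → ℂ) (x : Config N) : ℝ :=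
  ‖(DOp N α j Ψ x).1‖ ^ 2 + ‖(DOp N α j Ψ x).2‖ ^ 2

/-- The diagonal set `{x : x_j = x_k for some j ≠ k}`. -/
def diagSet (N : ℕ) : Set (Config N) := {x | ∃ j k : Fin N, j ≠ k ∧ x j = x k}

/-- Admissible wave functions: smooth, symmetric, vanishing on a neighbourhood of
the diagonal set. -/
structure Admissible (N : ℕ) (Ψ : Config N → ℂ) : Prop where
  smooth : ContDiff ℝ (⊤ : ℕ∞) Ψ
  symm : ∀ (σ : Equiv.Perm (Fin N)) (x : Config N), Ψ (x ∘ σ) = Ψ x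
  vanishes : ∃ U : Set (Config N), IsOpen U ∧ diagSet N ⊆ U ∧ ∀ x ∈ U, Ψ x = 0

/-- `Ω^N` as a subset of configuration space. -/
def cube (N : ℕ) (Ω : Set Plane) : Set (Config N) := Set.univ.pi fun _ => Ω

/-- Total kinetic energy `∑_j ∫_{Ω^N} |D_j Ψ|²`. -/
def kinE (N : ℕ) (α : ℝ) (Ω : Set Plane) (Ψ : Config N → ℂ) : ℝ :=
  ∑ j, ∫ x in cube N Ω, DSq N α j Ψ x

/-- `∫_{Ω^N} |Ψ|²`. -/
def normSq (N : ℕ) (Ω : Set Plane) (Ψ : Config N → ℂ) : ℝ :=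
  ∫ x in cube N Ω, ‖Ψ x‖ ^ 2

/-- Neumann ground-state energy of `N` anyons with statistics parameter `α` on `Ω`,
with the convention that it is `0` for `N = 0`. -/
def neumannE (N : ℕ) (α : ℝ) (Ω : Set Plane) : ℝ :=
  if N = 0 then 0 else
    sInf {E | ∃ Ψ : Config N → ℂ, Admissible N Ψ ∧ normSq N Ω Ψ = 1 ∧ E = kinE N α Ω Ψ}

/-- Dirichlet ground-state energy of `N` anyons with statistics parameter `α` on `Ω`. -/
def dirichletE (N : ℕ) (α : ℝ) (Ω : Set Plane) : ℝ :=
  sInf {E | ∃ Ψ : Config N → ℂ, Admissible N Ψ ∧ IsCompact (tsupport Ψ) ∧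
    tsupport Ψ ⊆ cube N Ω ∧ normSq N Ω Ψ = 1 ∧ E = kinE N α Ω Ψ}

/-- The open unit square `Q₀ = (0,1)²`. -/
def Q0 : Set Plane := Set.Ioo (0 : ℝ) 1 ×ˢ Set.Ioo (0 : ℝ) 1

/-- `E^N_N(α)`, the Neumann energy on the unit square. -/
def EN (N : ℕ) (α : ℝ) : ℝ := neumannE N α Q0

/-- `E^D_N(α)`, the Dirichlet energy on the unit square. -/
def ED (N : ℕ) (α : ℝ) : ℝ := dirichletE N α Q0

/-- One-particle density `ρ_Ψ` of a wave function of `n+1` particles. -/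
def density (n : ℕ) (Ψ : Config (n + 1) → ℂ) (y : Plane) : ℝ :=
  (n + 1) * ∫ z : Config n, ‖Ψ (Fin.cons y z)‖ ^ 2

open scoped ENNReal

/-- one-particle magnetic kinetic energy density with flux at `p`. -/
def dsq (α : ℝ) (p : Plane) (g : Plane → ℂ) (q : Plane) : ℝ :=
  ‖-Complex.I * fderiv ℝ g q (1, 0) + Complex.ofReal (α * (perpInv (q - p)).1) * g q‖ ^ 2 +
  ‖-Complex.I * fderiv ℝ g q (0, 1) + Complex.ofReal (α * (perpInv (q - p)).2) * g q‖ ^ 2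

lemma dsq_nonneg (α : ℝ) (p : Plane) (g : Plane → ℂ) (q : Plane) : 0 ≤ dsq α p g q := by
  unfold dsq; positivity

lemma slice1_fderiv {Ψ : Config 2 → ℂ} (h : ContDiff ℝ (⊤ : ℕ∞) Ψ) (p q v : Plane) :
    fderiv ℝ (fun q => Ψ ![p, q]) q v = fderiv ℝ Ψ ![p, q] (Pi.single 1 v) := by
  have h1 : HasFDerivAt Ψ (fderiv ℝ Ψ ![p, q]) ![p, q] :=
    (h.differentiable (by simp) _).hasFDerivAt
  have h2 : HasFDerivAt (fun q : Plane => (![p, q] : Config 2))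
      (ContinuousLinearMap.pi ![(0 : Plane →L[ℝ] Plane), ContinuousLinearMap.id ℝ Plane]) q := by
    rw [hasFDerivAt_pi']
    intro i
    fin_cases i
    · exact hasFDerivAt_const p q
    · exact hasFDerivAt_id q
  have h3 := h1.comp q h2
  have h4 : fderiv ℝ (fun q => Ψ ![p, q]) q = _ := h3.fderiv
  rw [h4]
  simp only [ContinuousLinearMap.comp_apply]
  congr 1
  funext i
  fin_cases i <;> simp

lemma slice0_fderiv {Ψ : Config 2 → ℂ} (h : ContDiff ℝ (⊤ : ℕ∞) Ψ) (p q v : Plane) :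
    fderiv ℝ (fun q => Ψ ![q, p]) q v = fderiv ℝ Ψ ![q, p] (Pi.single 0 v) := by
  have h1 : HasFDerivAt Ψ (fderiv ℝ Ψ ![q, p]) ![q, p] :=
    (h.differentiable (by simp) _).hasFDerivAt
  have h2 : HasFDerivAt (fun q : Plane => (![q, p] : Config 2))
      (ContinuousLinearMap.pi ![ContinuousLinearMap.id ℝ Plane, (0 : Plane →L[ℝ] Plane)]) q := by
    rw [hasFDerivAt_pi']
    intro i
    fin_cases i
    · exact hasFDerivAt_id q
    · exact hasFDerivAt_const p q
  have h3 := h1.comp q h2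
  have h4 : fderiv ℝ (fun q => Ψ ![q, p]) q = _ := h3.fderiv
  rw [h4]
  simp only [ContinuousLinearMap.comp_apply]
  congr 1
  funext i
  fin_cases i <;> simp

lemma adm_symm {Ψ : Config 2 → ℂ} (h : Admissible 2 Ψ) (p q : Plane) : Ψ ![q, p] = Ψ ![p, q] := by
  rw [← h.symm (Equiv.swap 0 1) ![p, q]]
  congr 1
  funext i
  fin_cases i <;> simp

lemma DSq_one {Ψ : Config 2 → ℂ} (h : Admissible 2 Ψ) (α : ℝ) (p q : Plane) :
    DSq 2 α 1 Ψ ![p, q] = dsq α p (fun q => Ψ ![p, q]) q := by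
  have e : (Finset.univ.erase (1 : Fin 2)) = {0} := by decide
  simp only [DSq, DOp, dsq, pder, slice1_fderiv h.smooth, abPot, e, Finset.sum_singleton]
  simp

lemma DSq_zero {Ψ : Config 2 → ℂ} (h : Admissible 2 Ψ) (α : ℝ) (p q : Plane) :
    DSq 2 α 0 Ψ ![q, p] = dsq α p (fun q => Ψ ![p, q]) q := by
  have e : (Finset.univ.erase (0 : Fin 2)) = {1} := by decide
  have e2 : (fun q => Ψ ![p, q]) = (fun q => Ψ ![q, p]) := by
    funext q; exact (adm_symm h p q).symm
  rw [e2]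
  simp only [DSq, DOp, dsq, pder, slice0_fderiv h.smooth, abPot, e, Finset.sum_singleton]
  simp

lemma cube_integral (F : Config 2 → ℝ) :
    ∫ x in cube 2 Q0, F x = ∫ z in Q0 ×ˢ Q0, F ![z.1, z.2] := by
  have := (volume_preserving_finTwoArrow Plane).setIntegral_preimage_emb
    (MeasurableEquiv.finTwoArrow (α := Plane)).measurableEmbedding (fun z => F ![z.1, z.2]) (Q0 ×ˢ Q0)
  rw [← this]
  have hs : cube 2 Q0 = (MeasurableEquiv.finTwoArrow (α := Plane)) ⁻¹' (Q0 ×ˢ Q0) := by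
    ext x
    simp [cube, MeasurableEquiv.finTwoArrow, Fin.forall_fin_two]
  rw [hs]
  refine integral_congr_ae (Filter.Eventually.of_forall fun x => ?_)
  simp only [MeasurableEquiv.finTwoArrow]
  congr 1
  funext i
  fin_cases i <;> simp

lemma measQ : MeasurableSet Q0 := measurableSet_Ioo.prod measurableSet_Ioo

lemma kinE_eq {Ψ : Config 2 → ℂ} (h : Admissible 2 Ψ) (α : ℝ) :
    kinE 2 α Q0 Ψ = 2 * ∫ z in Q0 ×ˢ Q0, dsq α z.1 (fun q => Ψ ![z.1, q]) z.2 := by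
  unfold kinE
  rw [Fin.sum_univ_two, cube_integral, cube_integral, two_mul]
  congr 1
  · have hp : MeasurePreserving (Prod.swap : Plane × Plane → Plane × Plane) volume volume :=
      Measure.measurePreserving_swap
    have := hp.setIntegral_preimage_emb MeasurableEquiv.prodComm.measurableEmbedding
      (fun z => DSq 2 α 0 Ψ ![z.1, z.2]) (Q0 ×ˢ Q0)
    rw [← this, Set.preimage_swap_prod]
    refine integral_congr_ae (Filter.Eventually.of_forall fun x => ?_)
    simp only [Prod.fst_swap, Prod.snd_swap]
    exact DSq_zero h α _ _
  · refine integral_congr_ae (Filter.Eventually.of_forall fun x => ?_)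
    exact DSq_one h α _ _

lemma normSq_eq (Ψ : Config 2 → ℂ) :
    normSq 2 Q0 Ψ = ∫ z in Q0 ×ˢ Q0, ‖Ψ ![z.1, z.2]‖ ^ 2 := by
  unfold normSq; rw [cube_integral]

/-- continuity of singular potential times vanishing function. -/
lemma cont_pot {X : Type*} [TopologicalSpace X] {w : X → Plane} {f : X → ℂ} (hw : Continuous w)
    (hf : Continuous f) (hz : ∀ x, w x = 0 → ∀ᶠ y in 𝓝 x, f y = 0) (α : ℝ) :
    Continuous (fun x => Complex.ofReal (α * (perpInv (w x)).1) * f x) ∧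
    Continuous (fun x => Complex.ofReal (α * (perpInv (w x)).2) * f x) := by
  constructor <;> rw [continuous_iff_continuousAt] <;> intro x <;> by_cases hx : w x = 0
  · have : (fun x => Complex.ofReal (α * (perpInv (w x)).1) * f x) =ᶠ[𝓝 x] fun _ => 0 := by
      filter_upwards [hz x hx] with y hy; simp [hy]
    exact continuousAt_const.congr this.symm
  · have h0 : (w x).1 ^ 2 + (w x).2 ^ 2 ≠ 0 := by
      intro h
      apply hx
      ext <;> simp <;> nlinarith [sq_nonneg (w x).1, sq_nonneg (w x).2]
    unfold perpInv
    refine ContinuousAt.mul ?_ hf.continuousAt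
    refine Complex.continuous_ofReal.continuousAt.comp ?_
    refine continuousAt_const.mul ?_
    exact ContinuousAt.div (by fun_prop) (by fun_prop) h0
  · have : (fun x => Complex.ofReal (α * (perpInv (w x)).2) * f x) =ᶠ[𝓝 x] fun _ => 0 := by
      filter_upwards [hz x hx] with y hy; simp [hy]
    exact continuousAt_const.congr this.symm
  · have h0 : (w x).1 ^ 2 + (w x).2 ^ 2 ≠ 0 := by
      intro h
      apply hx
      ext <;> simp <;> nlinarith [sq_nonneg (w x).1, sq_nonneg (w x).2]
    unfold perpInv
    refine ContinuousAt.mul ?_ hf.continuousAt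
    refine Complex.continuous_ofReal.continuousAt.comp ?_
    refine continuousAt_const.mul ?_
    exact ContinuousAt.div (by fun_prop) (by fun_prop) h0

lemma cont_two {Ψ : Config 2 → ℂ} (h : Continuous Ψ) :
    Continuous (fun z : Plane × Plane => Ψ ![z.1, z.2]) := by
  refine h.comp ?_
  refine continuous_pi fun i => ?_
  fin_cases i
  · exact continuous_fst
  · exact continuous_snd

lemma adm_zero {Ψ : Config 2 → ℂ} (h : Admissible 2 Ψ) (x : Plane × Plane) (hx : x.2 - x.1 = 0) :
    ∀ᶠ y : Plane × Plane in 𝓝 x, Ψ ![y.1, y.2] = 0 := by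
  obtain ⟨U, hU, hd, hz⟩ := h.vanishes
  have hc : Continuous (fun z : Plane × Plane => (![z.1, z.2] : Config 2)) := by
    refine continuous_pi fun i => ?_
    fin_cases i
    · exact continuous_fst
    · exact continuous_snd
  have : (![x.1, x.2] : Config 2) ∈ U := by
    apply hd
    refine ⟨0, 1, by simp, ?_⟩
    simp [(sub_eq_zero.mp hx)]
  filter_upwards [hc.continuousAt.preimage_mem_nhds (hU.mem_nhds this)] with y hy
  exact hz _ hy

lemma cont_dsq2 {Ψ : Config 2 → ℂ} (h : Admissible 2 Ψ) (α : ℝ) :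
    Continuous (fun z : Plane × Plane => dsq α z.1 (fun q => Ψ ![z.1, q]) z.2) := by
  obtain ⟨c1, c2⟩ := cont_pot (w := fun z : Plane × Plane => z.2 - z.1)
    (f := fun z : Plane × Plane => Ψ ![z.1, z.2]) (by fun_prop) (cont_two h.smooth.continuous)
    (fun x hx => adm_zero h x hx) α
  have hd : ∀ v, Continuous (fun z : Plane × Plane => fderiv ℝ Ψ ![z.1, z.2] (Pi.single 1 v)) := by
    intro v
    have : Continuous (fderiv ℝ Ψ) := h.smooth.continuous_fderiv (by simp)
    have h2 : Continuous (fun z : Plane × Plane => (![z.1, z.2] : Config 2)) := by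
      refine continuous_pi fun i => ?_
      fin_cases i
      · exact continuous_fst
      · exact continuous_snd
    exact (this.comp h2).clm_apply continuous_const
  simp only [dsq, slice1_fderiv h.smooth]
  have d1 := hd (1, 0)
  have d2 := hd (0, 1)
  fun_prop

/-- slices -/
lemma slice_smooth {Ψ : Config 2 → ℂ} (h : ContDiff ℝ (⊤ : ℕ∞) Ψ) (p : Plane) :
    ContDiff ℝ (⊤ : ℕ∞) (fun q => Ψ ![p, q]) := by
  refine h.comp ?_
  rw [contDiff_pi]
  intro i
  fin_cases i
  · exact contDiff_const
  · exact contDiff_id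

def disc (p : Plane) (d : ℝ) : Set Plane := {q | (q.1 - p.1) ^ 2 + (q.2 - p.2) ^ 2 < d ^ 2}

def ray (p : Plane) (r φ : ℝ) : Plane := (p.1 + r * cos φ, p.2 + r * sin φ)

lemma isOpen_disc (p : Plane) (d : ℝ) : IsOpen (disc p d) :=
  isOpen_lt (by fun_prop) (by fun_prop)

lemma polar_disc (p : Plane) {d : ℝ} (hd : 0 < d) {F : Plane → ℝ} (hF : Continuous F) :
    ∫ q in disc p d, F q = ∫ r in (0:ℝ)..d, ∫ φ in (-π)..π, r * F (ray p r φ) := by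
  rw [← integral_indicator (isOpen_disc p d).measurableSet,
    ← integral_add_left_eq_self _ p, ← integral_comp_polarCoord_symm]
  have h1 : ∀ z ∈ polarCoord.target,
      z.1 • (disc p d).indicator F (p + polarCoord.symm z) =
      (Ioo 0 d ×ˢ Ioo (-π) π).indicator (fun z : ℝ × ℝ => z.1 * F (ray p z.1 z.2)) z := by
    rintro ⟨r, φ⟩ hz
    simp only [polarCoord_target, mem_prod, mem_Ioi] at hz
    have e : p + polarCoord.symm (r, φ) = ray p r φ := by
      simp [polarCoord, ray, Prod.ext_iff]
    rw [e]
    have e2 : ray p r φ ∈ disc p d ↔ r < d := by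
      simp only [disc, ray, mem_ofPred_eq]
      have : (p.1 + r * cos φ - p.1) ^ 2 + (p.2 + r * sin φ - p.2) ^ 2 = r ^ 2 := by
        have := sin_sq_add_cos_sq φ
        linear_combination r ^ 2 * this
      rw [this, sq_lt_sq₀ hz.1.le hd.le]
    by_cases h : r < d
    · rw [indicator_of_mem (e2.2 h), indicator_of_mem (by simp_all)]
      simp
    · rw [indicator_of_notMem (fun h' => h (e2.1 h')), indicator_of_notMem (by simp_all)]
      simp
  rw [setIntegral_congr_fun polarCoord.open_target.measurableSet h1,
    setIntegral_indicator (measurableSet_Ioo.prod measurableSet_Ioo)]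
  have h2 : polarCoord.target ∩ (Ioo 0 d ×ˢ Ioo (-π) π) = Ioo 0 d ×ˢ Ioo (-π) π := by
    rw [polarCoord_target]
    ext z; simp; tauto
  rw [h2]
  have hc : Continuous (fun z : ℝ × ℝ => z.1 * F (ray p z.1 z.2)) := by
    unfold ray; fun_prop
  rw [Measure.volume_eq_prod, setIntegral_prod]
  · rw [intervalIntegral.integral_of_le hd.le, integral_Ioc_eq_integral_Ioo]
    refine setIntegral_congr_fun measurableSet_Ioo fun r _ => ?_
    simp only
    rw [intervalIntegral.integral_of_le (by linarith [pi_pos]), integral_Ioc_eq_integral_Ioo]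
  · have : IntegrableOn (fun z : ℝ × ℝ => z.1 * F (ray p z.1 z.2)) (Icc 0 d ×ˢ Icc (-π) π) :=
      hc.continuousOn.integrableOn_compact (isCompact_Icc.prod isCompact_Icc)
    exact this.mono_set (prod_mono Ioo_subset_Icc_self Ioo_subset_Icc_self)

lemma swap_int {F : ℝ → ℝ → ℝ} (hF : Continuous (Function.uncurry F)) (a b c d : ℝ) :
    ∫ x in a..b, ∫ y in c..d, F x y = ∫ y in c..d, ∫ x in a..b, F x y := by
  apply intervalIntegral_intervalIntegral_swap
  have : IntegrableOn (Function.uncurry F) (uIcc a b ×ˢ uIcc c d) :=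
    hF.continuousOn.integrableOn_compact (isCompact_uIcc.prod isCompact_uIcc)
  exact this.mono_set (prod_mono uIoc_subset_uIcc uIoc_subset_uIcc)

lemma circle_ineq {f f' : ℝ → ℂ} (hf : ∀ t, HasDerivAt f (f' t) t) (hc : Continuous f')
    (hper : f (-π) = f π) {α : ℝ} (h0 : 0 ≤ α) (h1 : α * (4 * π) ≤ 1) :
    α ^ 2 * ∫ t in (-π)..π, ‖f t‖ ^ 2 ≤ ∫ t in (-π)..π, ‖-Complex.I * f' t + α * f t‖ ^ 2 := by
  have cf : Continuous f := continuous_iff_continuousAt.2 fun t => (hf t).continuousAt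
  have hpi := pi_pos
  have hle : -π ≤ π := by linarith
  set M := ∫ t in (-π)..π, ‖f' t‖ with hM
  have hM0 : 0 ≤ M := intervalIntegral.integral_nonneg hle fun _ _ => norm_nonneg _
  -- sup bound
  have hsup : ∀ t ∈ Icc (-π) π, ‖f t - f (-π)‖ ≤ M := by
    intro t ht
    rw [← intervalIntegral.integral_eq_sub_of_hasDerivAt (f := f) (f' := f') (fun x _ => hf x)
      (hc.intervalIntegrable _ _)]
    refine (intervalIntegral.norm_integral_le_integral_norm ht.1).trans ?_
    refine intervalIntegral.integral_mono_interval le_rfl ht.1 ht.2 ?_ (hc.norm.intervalIntegrable _ _)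
    exact Filter.Eventually.of_forall fun _ => norm_nonneg _
  have hzero : ∫ t in (-π)..π, (f' t * (starRingEnd ℂ) (f (-π))).im = 0 := by
    have e : ∀ t, (f' t * (starRingEnd ℂ) (f (-π))).im =
        Complex.imCLM (f' t * (starRingEnd ℂ) (f (-π))) := fun _ => rfl
    simp_rw [e]
    rw [ContinuousLinearMap.intervalIntegral_comp_comm]
    · rw [intervalIntegral.integral_mul_const,
        intervalIntegral.integral_eq_sub_of_hasDerivAt (f := f) (f' := f') (fun x _ => hf x)
      (hc.intervalIntegrable _ _), hper]
      simp
    · exact (hc.mul continuous_const).intervalIntegrable _ _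
  have hCS : M ^ 2 ≤ 2 * π * ∫ t in (-π)..π, ‖f' t‖ ^ 2 := by
    have h : 0 ≤ ∫ t in (-π)..π, (‖f' t‖ ^ 2 - (M / π) * ‖f' t‖ + (M / (2 * π)) ^ 2) := by
      refine intervalIntegral.integral_nonneg hle fun t _ => ?_
      have : ‖f' t‖ ^ 2 - (M / π) * ‖f' t‖ + (M / (2 * π)) ^ 2 = (‖f' t‖ - M / (2 * π)) ^ 2 := by
        field_simp; ring
      rw [this]; positivity
    rw [intervalIntegral.integral_add, intervalIntegral.integral_sub,
      intervalIntegral.integral_const_mul, ← hM, intervalIntegral.integral_const] at h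
    · simp only [smul_eq_mul] at h
      have e : (π - -π) * (M / (2 * π)) ^ 2 = M ^ 2 / (2 * π) := by field_simp; ring
      have e2 : M / π * M = 2 * (M ^ 2 / (2 * π)) := by field_simp
      rw [e, e2] at h
      have : M ^ 2 / (2 * π) ≤ ∫ t in (-π)..π, ‖f' t‖ ^ 2 := by linarith
      rw [div_le_iff₀ (by positivity)] at this
      linarith
    all_goals
      exact Continuous.intervalIntegrable (by fun_prop) _ _
  -- pointwise
  have hpt : ∀ t ∈ Icc (-π) π, α ^ 2 * ‖f t‖ ^ 2 + (‖f' t‖ ^ 2 - (2 * α * M) * ‖f' t‖ +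
      2 * α * (f' t * (starRingEnd ℂ) (f (-π))).im) ≤ ‖-Complex.I * f' t + α * f t‖ ^ 2 := by
    intro t ht
    have e1 : ‖-Complex.I * f' t + α * f t‖ ^ 2 = ‖f' t‖ ^ 2 + α ^ 2 * ‖f t‖ ^ 2 +
        2 * α * (f' t * (starRingEnd ℂ) (f t)).im := by
      simp only [← Complex.normSq_eq_norm_sq, Complex.normSq_apply]
      simp
      ring
    have e2 : (f' t * (starRingEnd ℂ) (f t)).im = (f' t * (starRingEnd ℂ) (f (-π))).im +
        (f' t * (starRingEnd ℂ) (f t - f (-π))).im := by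
      simp; ring
    have e3 : -(M * ‖f' t‖) ≤ (f' t * (starRingEnd ℂ) (f t - f (-π))).im := by
      have := Complex.abs_im_le_norm (f' t * (starRingEnd ℂ) (f t - f (-π)))
      rw [norm_mul, RCLike.norm_conj] at this
      have h3 := mul_le_mul_of_nonneg_left (hsup t ht) (norm_nonneg (f' t))
      have := neg_abs_le ((f' t * (starRingEnd ℂ) (f t - f (-π))).im)
      linarith
    rw [e1, e2]
    have := mul_le_mul_of_nonneg_left e3 h0
    nlinarith
  have hint := intervalIntegral.integral_mono_on hle
    (Continuous.intervalIntegrable (μ := volume) (by fun_prop) _ _)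
    (Continuous.intervalIntegrable (μ := volume) (by fun_prop) _ _) hpt
  refine le_trans ?_ hint
  rw [intervalIntegral.integral_add, intervalIntegral.integral_add, intervalIntegral.integral_sub,
      intervalIntegral.integral_const_mul, intervalIntegral.integral_const_mul,
      intervalIntegral.integral_const_mul, hzero, ← hM]
  · have : α * M ^ 2 ≤ α * (2 * π * ∫ t in (-π)..π, ‖f' t‖ ^ 2) := mul_le_mul_of_nonneg_left hCS h0
    have h5 : 0 ≤ ∫ t in (-π)..π, ‖f' t‖ ^ 2 :=
      intervalIntegral.integral_nonneg hle fun _ _ => by positivity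
    nlinarith
  all_goals
    exact Continuous.intervalIntegrable (by fun_prop) _ _

lemma perpInv_ray (p : Plane) {r : ℝ} (hr : r ≠ 0) (φ : ℝ) :
    perpInv (ray p r φ - p) = (-sin φ / r, cos φ / r) := by
  have h := sin_sq_add_cos_sq φ
  have e : (r * cos φ) ^ 2 + (r * sin φ) ^ 2 = r ^ 2 := by linear_combination r ^ 2 * h
  simp only [perpInv, ray, Prod.fst_sub, Prod.snd_sub, add_sub_cancel_left, e]
  ext <;> simp <;> field_simp

lemma rot_id (X Y G : ℂ) (s c β : ℝ) (h : s ^ 2 + c ^ 2 = 1) :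
    ‖-Complex.I * X + Complex.ofReal (-s * β) * G‖ ^ 2 + ‖-Complex.I * Y + Complex.ofReal (c * β) * G‖ ^ 2
    = ‖c * X + s * Y‖ ^ 2 + ‖-Complex.I * (-s * X + c * Y) + β * G‖ ^ 2 := by
  simp only [← Complex.normSq_eq_norm_sq, Complex.normSq_apply]
  simp
  linear_combination (-(X.re ^ 2 + X.im ^ 2 + Y.re ^ 2 + Y.im ^ 2) + β ^ 2 * (G.re ^ 2 + G.im ^ 2)) * h

lemma ray_continuous (p : Plane) : Continuous (fun z : ℝ × ℝ => ray p z.1 z.2) := by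
  unfold ray; fun_prop

lemma dyson {g : Plane → ℂ} (hg : ContDiff ℝ (⊤ : ℕ∞) g) (p : Plane)
    (hz : ∀ᶠ q in 𝓝 p, g q = 0) {α : ℝ} (h0 : 0 < α) (h1 : α * (4 * π) ≤ 1) {d : ℝ} (hd : 0 < d) :
    2 * α / d ^ 2 * ∫ q in disc p d, ‖g q‖ ^ 2 ≤ ∫ q in disc p d, dsq α p g q := by
  have hpi := pi_pos
  have hle : -π ≤ π := by linarith
  have cg : Continuous g := hg.continuous
  have cdg : Continuous (fderiv ℝ g) := hg.continuous_fderiv (by simp)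
  obtain ⟨ca, cb⟩ := cont_pot (w := fun q : Plane => q - p) (f := g) (by fun_prop) cg
    (fun x hx => by rw [sub_eq_zero.1 hx]; exact hz) α
  have cdsq : Continuous (dsq α p g) := by
    have d1 : Continuous fun q => fderiv ℝ g q (1, 0) := cdg.clm_apply continuous_const
    have d2 : Continuous fun q => fderiv ℝ g q (0, 1) := cdg.clm_apply continuous_const
    unfold dsq
    fun_prop
  set a : Plane → ℂ := fun q => Complex.ofReal (α * (perpInv (q - p)).1) * g q with ha
  set b : Plane → ℂ := fun q => Complex.ofReal (α * (perpInv (q - p)).2) * g q with hb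
  set Gr : ℝ → ℝ → ℂ := fun r φ => fderiv ℝ g (ray p r φ) (cos φ, sin φ) with hGr
  set L : ℝ → ℝ → ℝ := fun r φ => r * (‖Gr r φ‖ ^ 2 + (‖a (ray p r φ)‖ ^ 2 + ‖b (ray p r φ)‖ ^ 2)) with hL
  have cray := ray_continuous p
  have cGr : Continuous (fun z : ℝ × ℝ => Gr z.1 z.2) := by
    refine (cdg.comp cray).clm_apply ?_
    fun_prop
  have cG : Continuous (fun z : ℝ × ℝ => g (ray p z.1 z.2)) := cg.comp cray
  have cR : Continuous (fun z : ℝ × ℝ => z.1 * dsq α p g (ray p z.1 z.2)) :=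
    continuous_fst.mul (cdsq.comp cray)
  have cL : Continuous (fun z : ℝ × ℝ => L z.1 z.2) := by
    have ca' : Continuous (fun z : ℝ × ℝ => a (ray p z.1 z.2)) := ca.comp cray
    have cb' : Continuous (fun z : ℝ × ℝ => b (ray p z.1 z.2)) := cb.comp cray
    simp only [hL]
    fun_prop
  have hab : ∀ r φ, 0 < r → ‖a (ray p r φ)‖ ^ 2 + ‖b (ray p r φ)‖ ^ 2 =
      (α / r) ^ 2 * ‖g (ray p r φ)‖ ^ 2 := by
    intro r φ hr
    simp only [ha, hb, norm_mul, Complex.norm_real, perpInv_ray p hr.ne', norm_eq_abs, mul_pow, sq_abs]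
    have h := sin_sq_add_cos_sq φ
    have : α ^ 2 * (-sin φ / r) ^ 2 + α ^ 2 * (cos φ / r) ^ 2 = (α / r) ^ 2 := by
      field_simp; linear_combination h
    rw [← this]; ring
  -- angular step
  have hang : ∀ r ∈ Icc 0 d, ∫ φ in (-π)..π, L r φ ≤
      ∫ φ in (-π)..π, r * dsq α p g (ray p r φ) := by
    intro r hr
    rcases hr.1.eq_or_lt with h | hr0
    · subst h; simp [hL]
    have hlin : ∀ φ, Gr r φ = cos φ * fderiv ℝ g (ray p r φ) (1, 0) +
        sin φ * fderiv ℝ g (ray p r φ) (0, 1) := by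
      intro φ
      have : ((cos φ, sin φ) : Plane) = cos φ • ((1, 0) : Plane) + sin φ • ((0, 1) : Plane) := by
        simp
      simp only [hGr]
      rw [this, map_add, map_smul, map_smul]
      simp
    have cf' : Continuous (fun φ => fderiv ℝ g (ray p r φ) (-(r * sin φ), r * cos φ)) := by
      refine (cdg.comp (f := fun φ => ray p r φ) (by unfold ray; fun_prop)).clm_apply ?_
      fun_prop
    have hf : ∀ φ, HasDerivAt (fun φ => g (ray p r φ))
        (fderiv ℝ g (ray p r φ) (-(r * sin φ), r * cos φ)) φ := by
      intro φ
      have h1 : HasDerivAt (fun φ => ray p r φ) (-(r * sin φ), r * cos φ) φ := by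
        unfold ray
        have e1 : HasDerivAt (fun φ => p.1 + r * cos φ) (-(r * sin φ)) φ := by
          simpa using ((hasDerivAt_cos φ).const_mul r).const_add p.1
        have e2 : HasDerivAt (fun φ => p.2 + r * sin φ) (r * cos φ) φ := by
          simpa using ((hasDerivAt_sin φ).const_mul r).const_add p.2
        exact e1.prodMk e2
      exact ((hg.differentiable (by simp) _).hasFDerivAt).comp_hasDerivAt φ h1
    have hci := circle_ineq hf cf' (by simp [ray]) h0.le h1
    have e1 : ∀ φ, L r φ = r * ‖Gr r φ‖ ^ 2 + r⁻¹ * α ^ 2 * ‖g (ray p r φ)‖ ^ 2 := by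
      intro φ
      simp only [hL]
      rw [hab r φ hr0]
      field_simp
    have e2 : ∀ φ, r * dsq α p g (ray p r φ) = r * ‖Gr r φ‖ ^ 2 +
        r⁻¹ * ‖-Complex.I * fderiv ℝ g (ray p r φ) (-(r * sin φ), r * cos φ) + α * g (ray p r φ)‖ ^ 2 := by
      intro φ
      have hl2 : fderiv ℝ g (ray p r φ) (-(r * sin φ), r * cos φ) =
          r * (- sin φ * fderiv ℝ g (ray p r φ) (1, 0) + cos φ * fderiv ℝ g (ray p r φ) (0, 1)) := by
        have : ((-(r * sin φ), r * cos φ) : Plane) =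
            (-(r * sin φ)) • ((1, 0) : Plane) + (r * cos φ) • ((0, 1) : Plane) := by
          simp
        rw [this, map_add, map_smul, map_smul]
        simp
        ring
      have hr' : (r : ℂ) ≠ 0 := by exact_mod_cast hr0.ne'
      have e3 : -Complex.I * fderiv ℝ g (ray p r φ) (-(r * sin φ), r * cos φ) + α * g (ray p r φ) =
          r * (-Complex.I * (- sin φ * fderiv ℝ g (ray p r φ) (1, 0) +
            cos φ * fderiv ℝ g (ray p r φ) (0, 1)) + ((α / r : ℝ) : ℂ) * g (ray p r φ)) := by
        rw [hl2]; push_cast; field_simp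
      rw [e3, norm_mul, hlin, dsq, perpInv_ray p hr0.ne']
      have e4 := rot_id (fderiv ℝ g (ray p r φ) (1, 0)) (fderiv ℝ g (ray p r φ) (0, 1))
        (g (ray p r φ)) (sin φ) (cos φ) (α / r) (sin_sq_add_cos_sq φ)
      have e5 : α * (-sin φ / r) = -sin φ * (α / r) := by ring
      have e6 : α * (cos φ / r) = cos φ * (α / r) := by ring
      simp only [e5, e6]
      rw [e4, Complex.norm_real, norm_eq_abs, mul_pow, sq_abs]
      field_simp
    simp_rw [e1, e2]
    have c1 : Continuous fun φ => Gr r φ := cGr.comp (by fun_prop : Continuous fun φ : ℝ => (r, φ))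
    have c2 : Continuous fun φ => g (ray p r φ) := cG.comp (by fun_prop : Continuous fun φ : ℝ => (r, φ))
    rw [intervalIntegral.integral_add, intervalIntegral.integral_add,
      intervalIntegral.integral_const_mul (r⁻¹ * α ^ 2), intervalIntegral.integral_const_mul r⁻¹]
    · have := mul_le_mul_of_nonneg_left hci (inv_nonneg.2 hr0.le)
      linarith
    all_goals
      exact Continuous.intervalIntegrable (by fun_prop) _ _
  -- radial step
  have hrad : ∀ φ, ∀ ρ ∈ Icc 0 d, α * ‖g (ray p ρ φ)‖ ^ 2 ≤ ∫ r in (0:ℝ)..d, L r φ := by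
    intro φ ρ hρ
    have hLn : ∀ r, 0 ≤ r → 0 ≤ L r φ := fun r hr => by simp only [hL]; positivity
    have c0 : Continuous fun r => L r φ := cL.comp (by fun_prop : Continuous fun r : ℝ => (r, φ))
    have c1 : Continuous fun r => Gr r φ := cGr.comp (by fun_prop : Continuous fun r : ℝ => (r, φ))
    have c2 : Continuous fun r => g (ray p r φ) := cG.comp (by fun_prop : Continuous fun r : ℝ => (r, φ))
    have step : ∫ r in (0:ℝ)..ρ, L r φ ≤ ∫ r in (0:ℝ)..d, L r φ := by
      refine intervalIntegral.integral_mono_interval le_rfl hρ.1 hρ.2 ?_ (c0.intervalIntegrable _ _)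
      filter_upwards [ae_restrict_mem measurableSet_Ioc] with r hr
      exact hLn r hr.1.le
    refine le_trans ?_ step
    have hder : ∀ r, HasDerivAt (fun r => ‖g (ray p r φ)‖ ^ 2)
        (2 * inner ℝ (g (ray p r φ)) (Gr r φ)) r := by
      intro r
      refine HasDerivAt.norm_sq ?_
      have h1 : HasDerivAt (fun r => ray p r φ) (cos φ, sin φ) r := by
        unfold ray
        have e1 : HasDerivAt (fun r => p.1 + r * cos φ) (cos φ) r := by
          simpa using ((hasDerivAt_id r).mul_const (cos φ)).const_add p.1
        have e2 : HasDerivAt (fun r => p.2 + r * sin φ) (sin φ) r := by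
          simpa using ((hasDerivAt_id r).mul_const (sin φ)).const_add p.2
        exact e1.prodMk e2
      exact ((hg.differentiable (by simp) _).hasFDerivAt).comp_hasDerivAt r h1
    have hgp : g (ray p 0 φ) = 0 := by
      have : ray p 0 φ = p := by simp [ray]
      rw [this]; exact hz.self_of_nhds
    have ci : Continuous fun r => 2 * inner ℝ (g (ray p r φ)) (Gr r φ) := by fun_prop
    have ftc := intervalIntegral.integral_eq_sub_of_hasDerivAt (a := 0) (b := ρ) (fun r _ => hder r)
      (ci.intervalIntegrable _ _)
    rw [hgp] at ftc
    simp only [norm_zero] at ftc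
    have e : ‖g (ray p ρ φ)‖ ^ 2 = ∫ r in (0:ℝ)..ρ, 2 * inner ℝ (g (ray p r φ)) (Gr r φ) := by
      rw [ftc]; simp
    rw [e, ← intervalIntegral.integral_const_mul]
    refine intervalIntegral.integral_mono_on hρ.1 ((ci.const_mul α).intervalIntegrable _ _)
      (c0.intervalIntegrable _ _) ?_
    intro r hr
    rcases hr.1.eq_or_lt with h | hr0
    · subst h; rw [hgp]; simp [hL]
    have h3 : inner ℝ (g (ray p r φ)) (Gr r φ) ≤ ‖g (ray p r φ)‖ * ‖Gr r φ‖ := real_inner_le_norm _ _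
    simp only [hL]
    rw [hab r φ hr0]
    have h4 : r * (‖Gr r φ‖ ^ 2 + (α / r) ^ 2 * ‖g (ray p r φ)‖ ^ 2) -
        α * (2 * (‖g (ray p r φ)‖ * ‖Gr r φ‖)) = r * (‖Gr r φ‖ - (α / r) * ‖g (ray p r φ)‖) ^ 2 := by
      field_simp; ring
    have h5 : 0 ≤ r * (‖Gr r φ‖ - (α / r) * ‖g (ray p r φ)‖) ^ 2 := by positivity
    nlinarith
  -- combine
  set T := ∫ r in (0:ℝ)..d, ∫ φ in (-π)..π, r * dsq α p g (ray p r φ) with hT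
  have cRi : Continuous fun r => ∫ φ in (-π)..π, r * dsq α p g (ray p r φ) :=
    intervalIntegral.continuous_parametric_intervalIntegral_of_continuous
      (f := fun r φ => r * dsq α p g (ray p r φ)) cR continuous_const
  have cLi : Continuous fun r => ∫ φ in (-π)..π, L r φ :=
    intervalIntegral.continuous_parametric_intervalIntegral_of_continuous
      (f := fun r φ => L r φ) cL continuous_const
  have cLi' : Continuous fun φ => ∫ r in (0:ℝ)..d, L r φ :=
    intervalIntegral.continuous_parametric_intervalIntegral_of_continuous
      (f := fun φ r => L r φ) (cL.comp continuous_swap) continuous_const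
  have cN : Continuous fun r => ∫ φ in (-π)..π, ‖g (ray p r φ)‖ ^ 2 :=
    intervalIntegral.continuous_parametric_intervalIntegral_of_continuous
      (f := fun r φ => ‖g (ray p r φ)‖ ^ 2)
      (by fun_prop : Continuous (fun z : ℝ × ℝ => ‖g (ray p z.1 z.2)‖ ^ 2)) continuous_const
  have hρ : ∀ ρ ∈ Icc 0 d, α * ∫ φ in (-π)..π, ‖g (ray p ρ φ)‖ ^ 2 ≤ T := by
    intro ρ hρ
    rw [← intervalIntegral.integral_const_mul]
    have s1 : ∫ φ in (-π)..π, α * ‖g (ray p ρ φ)‖ ^ 2 ≤ ∫ φ in (-π)..π, ∫ r in (0:ℝ)..d, L r φ := by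
      have c2 : Continuous fun φ => g (ray p ρ φ) := cG.comp (by fun_prop : Continuous fun φ : ℝ => (ρ, φ))
      refine intervalIntegral.integral_mono_on hle (Continuous.intervalIntegrable (by fun_prop) _ _)
        (cLi'.intervalIntegrable _ _) fun φ _ => hrad φ ρ hρ
    refine s1.trans ?_
    rw [← swap_int (F := L) cL]
    exact intervalIntegral.integral_mono_on hd.le (cLi.intervalIntegrable _ _)
      (cRi.intervalIntegrable _ _) hang
  rw [polar_disc p hd (by fun_prop : Continuous fun q => ‖g q‖ ^ 2), polar_disc p hd cdsq, ← hT]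
  have fin : α * ∫ r in (0:ℝ)..d, ∫ φ in (-π)..π, r * ‖g (ray p r φ)‖ ^ 2 ≤ T * (d ^ 2 / 2) := by
    have e : ∫ r in (0:ℝ)..d, T * r = T * (d ^ 2 / 2) := by
      rw [intervalIntegral.integral_const_mul, integral_id]; simp
    rw [← e]
    have i1 : IntervalIntegrable (fun r => α * (r * ∫ φ in (-π)..π, ‖g (ray p r φ)‖ ^ 2)) volume 0 d :=
      (continuous_const.mul (continuous_id.mul cN)).intervalIntegrable _ _
    have i2 : IntervalIntegrable (fun r => T * r) volume 0 d :=
      (continuous_const.mul continuous_id).intervalIntegrable _ _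
    simp_rw [← intervalIntegral.integral_const_mul]
    simp_rw [intervalIntegral.integral_const_mul]
    refine le_trans (le_of_eq (intervalIntegral.integral_const_mul α _).symm) ?_
    refine intervalIntegral.integral_mono_on hd.le i1 i2 fun r hr => ?_
    have := mul_le_mul_of_nonneg_left (hρ r hr) hr.1
    linarith
  rw [div_mul_eq_mul_div, div_le_iff₀ (by positivity)]
  linarith

lemma poinc1 {f f' : ℝ → ℝ} (hf : ∀ t, HasDerivAt f (f' t) t) (hc : Continuous f') :
    ∫⁻ x in Ioo (0:ℝ) 1, ∫⁻ y in Ioo (0:ℝ) 1, ENNReal.ofReal ((f x - f y) ^ 2) ≤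
      ∫⁻ x in Ioo (0:ℝ) 1, ENNReal.ofReal (f' x ^ 2) := by
  set M := ∫ t in (0:ℝ)..1, |f' t| with hM
  set D := ∫ t in (0:ℝ)..1, f' t ^ 2 with hD
  have hMD : M ^ 2 ≤ D := by
    have h : 0 ≤ ∫ t in (0:ℝ)..1, (f' t ^ 2 - (2 * M) * |f' t| + M ^ 2) := by
      refine intervalIntegral.integral_nonneg zero_le_one fun t _ => ?_
      have : f' t ^ 2 - (2 * M) * |f' t| + M ^ 2 = (|f' t| - M) ^ 2 := by
        rw [← sq_abs (f' t)]; ring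
      rw [this]; positivity
    rw [intervalIntegral.integral_add, intervalIntegral.integral_sub,
      intervalIntegral.integral_const_mul, ← hM, ← hD, intervalIntegral.integral_const] at h
    · simp at h; nlinarith
    all_goals
      exact Continuous.intervalIntegrable (by fun_prop) _ _
  have key : ∀ x ∈ Ioo (0:ℝ) 1, ∀ y ∈ Ioo (0:ℝ) 1, (f x - f y) ^ 2 ≤ D := by
    have aux : ∀ x ∈ Ioo (0:ℝ) 1, ∀ y ∈ Ioo (0:ℝ) 1, y ≤ x → (f x - f y) ^ 2 ≤ D := by
      intro x hx y hy hyx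
      refine le_trans ?_ hMD
      rw [← sq_abs]
      refine pow_le_pow_left₀ (abs_nonneg _) ?_ 2
      rw [← intervalIntegral.integral_eq_sub_of_hasDerivAt (f := f) (f' := f') (fun x _ => hf x)
        (hc.intervalIntegrable _ _)]
      refine (intervalIntegral.abs_integral_le_integral_abs hyx).trans ?_
      refine intervalIntegral.integral_mono_interval hy.1.le hyx hx.2.le ?_ (hc.abs.intervalIntegrable _ _)
      exact Filter.Eventually.of_forall fun _ => abs_nonneg _
    intro x hx y hy
    rcases le_total y x with h | h
    · exact aux x hx y hy h
    · have := aux y hy x hx h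
      nlinarith
  have e : ∫⁻ x in Ioo (0:ℝ) 1, ENNReal.ofReal (f' x ^ 2) = ENNReal.ofReal D := by
    rw [← ofReal_integral_eq_lintegral_ofReal, hD, intervalIntegral.integral_of_le zero_le_one,
      integral_Ioc_eq_integral_Ioo]
    · exact ((by fun_prop : Continuous fun x => f' x ^ 2).integrableOn_Icc (a := 0) (b := 1)).mono_set
        Ioo_subset_Icc_self
    · exact Filter.Eventually.of_forall fun _ => sq_nonneg _
  rw [e]
  calc _ ≤ ∫⁻ x in Ioo (0:ℝ) 1, ∫⁻ y in Ioo (0:ℝ) 1, ENNReal.ofReal D := by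
        refine setLIntegral_mono' measurableSet_Ioo fun x hx => ?_
        refine setLIntegral_mono' measurableSet_Ioo fun y hy => ?_
        exact ENNReal.ofReal_le_ofReal (key x hx y hy)
    _ = ENNReal.ofReal D := by simp

lemma tensor {X Y : Type*} [MeasurableSpace X] [MeasurableSpace Y] (μ : Measure X) (ν : Measure Y)
    [IsProbabilityMeasure μ] [IsProbabilityMeasure ν] {u : X × Y → ℝ} (hu : Measurable u) :
    ∫⁻ z, ∫⁻ z', ENNReal.ofReal ((u z - u z') ^ 2) ∂(μ.prod ν) ∂(μ.prod ν) ≤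
    2 * ∫⁻ x, ∫⁻ y, ∫⁻ y', ENNReal.ofReal ((u (x, y) - u (x, y')) ^ 2) ∂ν ∂ν ∂μ +
    2 * ∫⁻ y, ∫⁻ x, ∫⁻ x', ENNReal.ofReal ((u (x, y) - u (x', y)) ^ 2) ∂μ ∂μ ∂ν := by
  have m1 : Measurable fun w : (X × Y) × (X × Y) => ENNReal.ofReal ((u w.1 - u w.2) ^ 2) := by fun_prop
  rw [lintegral_prod _ (Measurable.lintegral_prod_right' m1).aemeasurable]
  have e : ∀ x y, ∫⁻ z', ENNReal.ofReal ((u (x, y) - u z') ^ 2) ∂(μ.prod ν) =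
      ∫⁻ x', ∫⁻ y', ENNReal.ofReal ((u (x, y) - u (x', y')) ^ 2) ∂ν ∂μ := by
    intro x y
    rw [lintegral_prod]
    fun_prop
  simp_rw [e]
  have pt : ∀ x y x' y', ENNReal.ofReal ((u (x, y) - u (x', y')) ^ 2) ≤
      2 * ENNReal.ofReal ((u (x, y) - u (x, y')) ^ 2) +
      2 * ENNReal.ofReal ((u (x, y') - u (x', y')) ^ 2) := by
    intro x y x' y'
    rw [← ENNReal.ofReal_ofNat 2, ← ENNReal.ofReal_mul zero_le_two, ← ENNReal.ofReal_mul zero_le_two,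
      ← ENNReal.ofReal_add (by positivity) (by positivity)]
    apply ENNReal.ofReal_le_ofReal
    nlinarith [sq_nonneg ((u (x, y) - u (x, y')) - (u (x, y') - u (x', y')))]
  have m2 : Measurable fun w : ((X × Y) × X) × Y => ENNReal.ofReal ((u w.1.1 - u (w.1.1.1, w.2)) ^ 2) := by
    fun_prop
  have m2' : Measurable fun w : (X × Y) × Y => ENNReal.ofReal ((u w.1 - u (w.1.1, w.2)) ^ 2) := by
    fun_prop
  have m3 : Measurable fun w : (X × X) × Y => ENNReal.ofReal ((u (w.1.1, w.2) - u (w.1.2, w.2)) ^ 2) := by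
    fun_prop
  calc _ ≤ ∫⁻ x, ∫⁻ y, ∫⁻ x', ∫⁻ y', (2 * ENNReal.ofReal ((u (x, y) - u (x, y')) ^ 2) +
      2 * ENNReal.ofReal ((u (x, y') - u (x', y')) ^ 2)) ∂ν ∂μ ∂ν ∂μ := by
        refine lintegral_mono fun x => lintegral_mono fun y => lintegral_mono fun x' =>
          lintegral_mono fun y' => pt x y x' y'
    _ = ∫⁻ x, ∫⁻ y, (2 * ∫⁻ y', ENNReal.ofReal ((u (x, y) - u (x, y')) ^ 2) ∂ν +
      2 * ∫⁻ x', ∫⁻ y', ENNReal.ofReal ((u (x, y') - u (x', y')) ^ 2) ∂ν ∂μ) ∂ν ∂μ := by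
        refine lintegral_congr fun x => lintegral_congr fun y => ?_
        have : ∀ x', ∫⁻ y', (2 * ENNReal.ofReal ((u (x, y) - u (x, y')) ^ 2) +
          2 * ENNReal.ofReal ((u (x, y') - u (x', y')) ^ 2)) ∂ν =
          2 * ∫⁻ y', ENNReal.ofReal ((u (x, y) - u (x, y')) ^ 2) ∂ν +
          2 * ∫⁻ y', ENNReal.ofReal ((u (x, y') - u (x', y')) ^ 2) ∂ν := by
          intro x'
          rw [lintegral_add_left (by fun_prop), lintegral_const_mul _ (by fun_prop),
            lintegral_const_mul _ (by fun_prop)]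
        simp_rw [this]
        have k0 : Measurable fun x' => ∫⁻ y', ENNReal.ofReal ((u (x, y') - u (x', y')) ^ 2) ∂ν :=
          Measurable.lintegral_prod_right' (f := fun w : X × Y =>
            ENNReal.ofReal ((u (x, w.2) - u (w.1, w.2)) ^ 2)) (by fun_prop)
        rw [lintegral_add_left (by fun_prop), lintegral_const_mul _ k0]
        simp
    _ = ∫⁻ x, (2 * ∫⁻ y, ∫⁻ y', ENNReal.ofReal ((u (x, y) - u (x, y')) ^ 2) ∂ν ∂ν +
      2 * ∫⁻ x', ∫⁻ y', ENNReal.ofReal ((u (x, y') - u (x', y')) ^ 2) ∂ν ∂μ) ∂μ := by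
        refine lintegral_congr fun x => ?_
        rw [lintegral_add_right _ (by fun_prop), lintegral_const_mul]
        · simp
        · exact Measurable.lintegral_prod_right' (f := fun w : Y × Y =>
            ENNReal.ofReal ((u (x, w.1) - u (x, w.2)) ^ 2)) (by fun_prop)
    _ = 2 * ∫⁻ x, ∫⁻ y, ∫⁻ y', ENNReal.ofReal ((u (x, y) - u (x, y')) ^ 2) ∂ν ∂ν ∂μ +
      2 * ∫⁻ x, ∫⁻ x', ∫⁻ y', ENNReal.ofReal ((u (x, y') - u (x', y')) ^ 2) ∂ν ∂μ ∂μ := by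
        have k1 : Measurable fun x => ∫⁻ y, ∫⁻ y', ENNReal.ofReal ((u (x, y) - u (x, y')) ^ 2) ∂ν ∂ν :=
          Measurable.lintegral_prod_right' (f := fun w : X × Y =>
            ∫⁻ y', ENNReal.ofReal ((u (w.1, w.2) - u (w.1, y')) ^ 2) ∂ν)
            (Measurable.lintegral_prod_right' m2')
        have k2 : Measurable fun x => ∫⁻ x', ∫⁻ y', ENNReal.ofReal ((u (x, y') - u (x', y')) ^ 2) ∂ν ∂μ :=
          Measurable.lintegral_prod_right' (f := fun w : X × X =>
            ∫⁻ y', ENNReal.ofReal ((u (w.1, y') - u (w.2, y')) ^ 2) ∂ν)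
            (Measurable.lintegral_prod_right' m3)
        rw [lintegral_add_left (k1.const_mul 2), lintegral_const_mul _ k1, lintegral_const_mul _ k2]
    _ = _ := by
        congr 2
        have : ∀ x, ∫⁻ x', ∫⁻ y', ENNReal.ofReal ((u (x, y') - u (x', y')) ^ 2) ∂ν ∂μ =
          ∫⁻ y', ∫⁻ x', ENNReal.ofReal ((u (x, y') - u (x', y')) ^ 2) ∂μ ∂ν := by
          intro x
          refine lintegral_lintegral_swap (Measurable.aemeasurable ?_)
          simp only [Function.uncurry_def]
          fun_prop
        simp_rw [this]
        refine lintegral_lintegral_swap (Measurable.aemeasurable ?_)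
        simp only [Function.uncurry_def]
        refine Measurable.lintegral_prod_right' (f := fun w : (X × Y) × X =>
            ENNReal.ofReal ((u (w.1.1, w.1.2) - u (w.2, w.1.2)) ^ 2)) (by fun_prop)

instance probIoo : IsProbabilityMeasure ((volume : Measure ℝ).restrict (Ioo 0 1)) :=
  ⟨by simp⟩

lemma restrQ : (volume : Measure Plane).restrict Q0 =
    ((volume : Measure ℝ).restrict (Ioo 0 1)).prod ((volume : Measure ℝ).restrict (Ioo 0 1)) := by
  rw [Measure.prod_restrict, ← Measure.volume_eq_prod]; rfl

instance probQ : IsProbabilityMeasure ((volume : Measure Plane).restrict Q0) := by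
  rw [restrQ]; infer_instance

lemma poinc2 {h : Plane → ℝ} (hh : ContDiff ℝ 1 h) :
    ∫⁻ x in Q0, ∫⁻ y in Q0, ENNReal.ofReal ((h x - h y) ^ 2) ≤
      2 * ∫⁻ x in Q0, ENNReal.ofReal (fderiv ℝ h x (1, 0) ^ 2 + fderiv ℝ h x (0, 1) ^ 2) := by
  have hd := hh.differentiable (by simp)
  have cd : Continuous (fderiv ℝ h) := hh.continuous_fderiv (by simp)
  have c1 : Continuous fun x => fderiv ℝ h x (1, 0) := cd.clm_apply continuous_const
  have c2 : Continuous fun x => fderiv ℝ h x (0, 1) := cd.clm_apply continuous_const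
  have s1 : ∀ x, ∫⁻ y in Ioo (0:ℝ) 1, ∫⁻ y' in Ioo (0:ℝ) 1, ENNReal.ofReal ((h (x, y) - h (x, y')) ^ 2) ≤
      ∫⁻ y in Ioo (0:ℝ) 1, ENNReal.ofReal (fderiv ℝ h (x, y) (0, 1) ^ 2) := by
    intro x
    refine poinc1 (f := fun y => h (x, y)) (f' := fun y => fderiv ℝ h (x, y) (0, 1)) (fun t => ?_) (by fun_prop)
    exact (hd _).hasFDerivAt.comp_hasDerivAt t ((hasDerivAt_const t x).prodMk (hasDerivAt_id t))
  have s2 : ∀ y, ∫⁻ x in Ioo (0:ℝ) 1, ∫⁻ x' in Ioo (0:ℝ) 1, ENNReal.ofReal ((h (x, y) - h (x', y)) ^ 2) ≤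
      ∫⁻ x in Ioo (0:ℝ) 1, ENNReal.ofReal (fderiv ℝ h (x, y) (1, 0) ^ 2) := by
    intro y
    refine poinc1 (f := fun x => h (x, y)) (f' := fun x => fderiv ℝ h (x, y) (1, 0)) (fun t => ?_) (by fun_prop)
    exact (hd _).hasFDerivAt.comp_hasDerivAt t ((hasDerivAt_id t).prodMk (hasDerivAt_const t y))
  have e : ∀ x, ENNReal.ofReal (fderiv ℝ h x (1, 0) ^ 2 + fderiv ℝ h x (0, 1) ^ 2) =
      ENNReal.ofReal (fderiv ℝ h x (1, 0) ^ 2) + ENNReal.ofReal (fderiv ℝ h x (0, 1) ^ 2) :=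
    fun x => ENNReal.ofReal_add (by positivity) (by positivity)
  simp_rw [e]
  rw [lintegral_add_left (by fun_prop), restrQ]
  refine (tensor _ _ hh.continuous.measurable).trans ?_
  rw [add_comm, mul_add]
  refine add_le_add (mul_le_mul_right ?_ _) (mul_le_mul_right ?_ _)
  · rw [lintegral_prod_symm _ (by fun_prop)]
    exact lintegral_mono fun y => s2 y
  · rw [lintegral_prod _ (by fun_prop)]
    exact lintegral_mono fun x => s1 x

lemma restrQQ : (volume : Measure (Plane × Plane)).restrict (Q0 ×ˢ Q0) =
    ((volume : Measure Plane).restrict Q0).prod ((volume : Measure Plane).restrict Q0) := by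
  rw [Measure.prod_restrict]; rfl

lemma poinc4 {u : Plane × Plane → ℝ} (hu : Continuous u) (hs : ∀ p q, u (q, p) = u (p, q))
    (hd : ∀ p, ContDiff ℝ 1 (fun q => u (p, q))) :
    ∫⁻ z in Q0 ×ˢ Q0, ∫⁻ z' in Q0 ×ˢ Q0, ENNReal.ofReal ((u z - u z') ^ 2) ≤
      8 * ∫⁻ p in Q0, ∫⁻ q in Q0, ENNReal.ofReal
        (fderiv ℝ (fun q => u (p, q)) q (1, 0) ^ 2 + fderiv ℝ (fun q => u (p, q)) q (0, 1) ^ 2) := by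
  rw [restrQQ]
  refine (tensor _ _ hu.measurable).trans ?_
  have : ∀ y x x', u (x, y) - u (x', y) = u (y, x) - u (y, x') := by
    intro y x x'; rw [hs y x, hs y x']
  simp_rw [this]
  rw [← add_mul, (by norm_num : (8 : ℝ≥0∞) = (2 + 2) * 2), mul_assoc]
  refine mul_le_mul_right ?_ _
  rw [← lintegral_const_mul' _ _ (by simp)]
  exact lintegral_mono fun p => poinc2 (hd p)

instance probQQ : IsProbabilityMeasure ((volume : Measure (Plane × Plane)).restrict (Q0 ×ˢ Q0)) := by
  rw [restrQQ]; infer_instance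

lemma intQQ {E : Type*} [NormedAddCommGroup E] {f : Plane × Plane → E} (hf : Continuous f) :
    IntegrableOn f (Q0 ×ˢ Q0) := by
  have : IntegrableOn f (Icc 0 1 ×ˢ Icc 0 1) :=
    hf.continuousOn.integrableOn_compact (isCompact_Icc.prod isCompact_Icc)
  refine this.mono_set ?_
  have : Q0 ⊆ Icc (0 : Plane) 1 := by
    rintro ⟨x, y⟩ ⟨h1, h2⟩
    exact ⟨⟨h1.1.le, h2.1.le⟩, ⟨h1.2.le, h2.2.le⟩⟩
  exact prod_mono this this

/-- Poincaré inequality with real integrals. -/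
lemma poinc_real {u D : Plane × Plane → ℝ} (hu : Continuous u) (hs : ∀ p q, u (q, p) = u (p, q))
    (hd : ∀ p, ContDiff ℝ 1 (fun q => u (p, q))) (hD : Continuous D)
    (hDu : ∀ p q, fderiv ℝ (fun q => u (p, q)) q (1, 0) ^ 2 + fderiv ℝ (fun q => u (p, q)) q (0, 1) ^ 2
      ≤ D (p, q)) :
    (∫ z in Q0 ×ˢ Q0, u z ^ 2) - (∫ z in Q0 ×ˢ Q0, u z) ^ 2 ≤ 4 * ∫ z in Q0 ×ˢ Q0, D z := by
  have hD0 : ∀ z, 0 ≤ D z := fun z => le_trans (by positivity) (hDu z.1 z.2)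
  have hp := poinc4 hu hs hd
  set c := ∫ z in Q0 ×ˢ Q0, u z with hc
  set S := ∫ z in Q0 ×ˢ Q0, u z ^ 2 with hS
  have i1 : IntegrableOn u (Q0 ×ˢ Q0) := intQQ hu
  have i2 : IntegrableOn (fun z => u z ^ 2) (Q0 ×ˢ Q0) := intQQ (by fun_prop)
  have in1 : ∀ z, ∫⁻ z' in Q0 ×ˢ Q0, ENNReal.ofReal ((u z - u z') ^ 2) =
      ENNReal.ofReal (u z ^ 2 - (2 * c) * u z + S) := by
    intro z
    rw [← ofReal_integral_eq_lintegral_ofReal (intQQ (by fun_prop))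
      (Filter.Eventually.of_forall fun _ => sq_nonneg _)]
    congr 1
    have : ∀ z', (u z - u z') ^ 2 = u z ^ 2 - (2 * u z) * u z' + u z' ^ 2 := fun z' => by ring
    simp_rw [this]
    rw [integral_add (intQQ (by fun_prop)) i2, integral_sub (intQQ (by fun_prop)) (intQQ (by fun_prop)),
      integral_const_mul]
    simp
    ring
  simp_rw [in1] at hp
  have hnn : ∀ z, 0 ≤ u z ^ 2 - (2 * c) * u z + S := by
    intro z
    have hh : 0 ≤ ∫ z' in Q0 ×ˢ Q0, (u z - u z') ^ 2 := integral_nonneg fun _ => sq_nonneg _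
    have : ∀ z', (u z - u z') ^ 2 = u z ^ 2 - (2 * u z) * u z' + u z' ^ 2 := fun z' => by ring
    simp_rw [this] at hh
    rw [integral_add (intQQ (by fun_prop)) i2, integral_sub (intQQ (by fun_prop)) (intQQ (by fun_prop)),
      integral_const_mul] at hh
    simp at hh
    linarith
  rw [← ofReal_integral_eq_lintegral_ofReal (intQQ (by fun_prop))
      (Filter.Eventually.of_forall hnn)] at hp
  have e1 : ∫ z in Q0 ×ˢ Q0, (u z ^ 2 - (2 * c) * u z + S) = 2 * S - 2 * c ^ 2 := by
    rw [integral_add (intQQ (by fun_prop)) (intQQ (by fun_prop)),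
      integral_sub (intQQ (by fun_prop)) (intQQ (by fun_prop)), integral_const_mul]
    simp
    ring
  rw [e1] at hp
  have e2 : ∫⁻ p in Q0, ∫⁻ q in Q0, ENNReal.ofReal
        (fderiv ℝ (fun q => u (p, q)) q (1, 0) ^ 2 + fderiv ℝ (fun q => u (p, q)) q (0, 1) ^ 2) ≤
      ENNReal.ofReal (∫ z in Q0 ×ˢ Q0, D z) := by
    rw [ofReal_integral_eq_lintegral_ofReal (intQQ hD) (Filter.Eventually.of_forall hD0),
      restrQQ, lintegral_prod _ (by fun_prop)]
    exact lintegral_mono fun p => lintegral_mono fun q => ENNReal.ofReal_le_ofReal (hDu p q)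
  have e3 := hp.trans (mul_le_mul_right e2 8)
  rw [← ENNReal.ofReal_ofNat 8, ← ENNReal.ofReal_mul (by norm_num), ENNReal.ofReal_le_ofReal_iff] at e3
  · linarith
  · exact mul_nonneg (by norm_num) (integral_nonneg hD0)

/-- distance to the boundary of the unit square -/
def dd (p : Plane) : ℝ := min (min p.1 (1 - p.1)) (min p.2 (1 - p.2))

def Sq (η : ℝ) : Set Plane := Icc η (1 - η) ×ˢ Icc η (1 - η)

lemma Sq_dd {η : ℝ} {p : Plane} (hp : p ∈ Sq η) : η ≤ dd p := by
  obtain ⟨h1, h2⟩ := hp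
  simp only [dd, le_min_iff]
  exact ⟨⟨h1.1, by linarith [h1.2]⟩, ⟨h2.1, by linarith [h2.2]⟩⟩

lemma disc_sub {p : Plane} (hp : 0 < dd p) : disc p (dd p) ⊆ Q0 := by
  rintro q hq
  have hq' : (q.1 - p.1) ^ 2 + (q.2 - p.2) ^ 2 < dd p ^ 2 := hq
  have a1 : |q.1 - p.1| < dd p := abs_lt_of_sq_lt_sq (by nlinarith [sq_nonneg (q.2 - p.2)]) hp.le
  have a2 : |q.2 - p.2| < dd p := abs_lt_of_sq_lt_sq (by nlinarith [sq_nonneg (q.1 - p.1)]) hp.le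
  have b1 : dd p ≤ p.1 := (min_le_left _ _).trans (min_le_left _ _)
  have b2 : dd p ≤ 1 - p.1 := (min_le_left _ _).trans (min_le_right _ _)
  have b3 : dd p ≤ p.2 := (min_le_right _ _).trans (min_le_left _ _)
  have b4 : dd p ≤ 1 - p.2 := (min_le_right _ _).trans (min_le_right _ _)
  rw [abs_lt] at a1 a2
  exact ⟨⟨by linarith, by linarith⟩, ⟨by linarith, by linarith⟩⟩

def WS (η : ℝ) : Set (Plane × Plane) := {z | z.1 ∈ Sq η ∧ z.2 ∈ disc z.1 (dd z.1)}

def W (η : ℝ) : Plane × Plane → ℝ := (WS η).indicator fun z => (dd z.1 ^ 2)⁻¹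

lemma cont_dd : Continuous dd := by unfold dd; fun_prop

lemma meas_Sq (η : ℝ) : MeasurableSet (Sq η) := measurableSet_Icc.prod measurableSet_Icc

lemma meas_W (η : ℝ) : Measurable (W η) := by
  have := cont_dd
  refine Measurable.indicator ?_ ?_
  · have : Measurable dd := this.measurable
    fun_prop
  · refine MeasurableSet.inter ?_ ?_
    · exact measurable_fst (meas_Sq η)
    · exact (isOpen_lt (f := fun z : Plane × Plane => (z.2.1 - z.1.1) ^ 2 + (z.2.2 - z.1.2) ^ 2)
        (g := fun z => dd z.1 ^ 2) (by fun_prop) (by fun_prop)).measurableSet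

lemma W_nonneg (η : ℝ) (z) : 0 ≤ W η z := by
  unfold W; exact indicator_nonneg (fun _ _ => by positivity) _

lemma W_le {η : ℝ} (h : 0 < η) (z) : W η z ≤ (η ^ 2)⁻¹ := by
  unfold W
  by_cases hz : z ∈ WS η
  · rw [indicator_of_mem hz]
    have := Sq_dd hz.1
    gcongr
  · rw [indicator_of_notMem hz]; positivity

lemma int_W {η : ℝ} (h : 0 < η) {F : Plane × Plane → ℝ} (hF : IntegrableOn F (Q0 ×ˢ Q0)) :
    IntegrableOn (fun z => W η z * F z) (Q0 ×ˢ Q0) := by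
  refine Integrable.bdd_mul (c := (η ^ 2)⁻¹) hF (meas_W η).aestronglyMeasurable ?_
  refine Filter.Eventually.of_forall fun z => ?_
  rw [norm_eq_abs, abs_of_nonneg (W_nonneg η z)]
  exact W_le h z

lemma fubQQ {F : Plane × Plane → ℝ} (hF : IntegrableOn F (Q0 ×ˢ Q0)) :
    ∫ z in Q0 ×ˢ Q0, F z = ∫ p in Q0, ∫ q in Q0, F (p, q) := by
  unfold IntegrableOn at hF
  rw [restrQQ] at hF ⊢
  exact integral_prod _ hF

lemma W_inner {η : ℝ} (h : 0 < η) {p : Plane} (hp : p ∈ Sq η) (F : Plane → ℝ) :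
    ∫ q in Q0, W η (p, q) * F q = (dd p ^ 2)⁻¹ * ∫ q in disc p (dd p), F q := by
  have hd : 0 < dd p := h.trans_le (Sq_dd hp)
  have e : ∀ q, W η (p, q) * F q = (disc p (dd p)).indicator (fun q => (dd p ^ 2)⁻¹ * F q) q := by
    intro q
    by_cases hq : q ∈ disc p (dd p)
    · rw [indicator_of_mem hq, W, indicator_of_mem (show (p, q) ∈ WS η from ⟨hp, hq⟩)]
    · rw [indicator_of_notMem hq, W, indicator_of_notMem (fun h' => hq h'.2)]
      simp
  simp_rw [e]
  rw [setIntegral_indicator (isOpen_disc _ _).measurableSet, inter_eq_right.2 (disc_sub hd),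
    integral_const_mul]

lemma W_out {η : ℝ} {p : Plane} (hp : p ∉ Sq η) (q : Plane) : W η (p, q) = 0 := by
  rw [W, indicator_of_notMem (fun h' => hp h'.1)]

lemma disc_area (p : Plane) {d : ℝ} (hd : 0 < d) : ∫ _q in disc p d, (1 : ℝ) = π * d ^ 2 := by
  rw [polar_disc p hd continuous_const]
  have e : ∀ r : ℝ, ∫ _φ in (-π)..π, r * (1:ℝ) = (2 * π) * r := by
    intro r
    rw [intervalIntegral.integral_const, smul_eq_mul]; ring
  simp_rw [e]
  rw [intervalIntegral.integral_const_mul, integral_id]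
  ring

lemma Sq_sub {η : ℝ} (h : 0 < η) : Sq η ⊆ Q0 :=
  prod_mono (fun x hx => ⟨by linarith [hx.1], by linarith [hx.2]⟩)
    (fun x hx => ⟨by linarith [hx.1], by linarith [hx.2]⟩)

lemma W_int {η : ℝ} (h : 0 < η) (h2 : η < 1 / 2) : ∫ z in Q0 ×ˢ Q0, W η z = π * (1 - 2 * η) ^ 2 := by
  have i : IntegrableOn (W η) (Q0 ×ˢ Q0) := by
    have := int_W h (F := fun _ => 1) (intQQ continuous_const)
    simpa using this
  rw [fubQQ i]
  have e : ∀ p, ∫ q in Q0, W η (p, q) = (Sq η).indicator (fun _ => π) p := by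
    intro p
    by_cases hp : p ∈ Sq η
    · have := W_inner h hp (fun _ => 1)
      have hd : 0 < dd p := h.trans_le (Sq_dd hp)
      rw [disc_area p hd] at this
      simp only [mul_one] at this
      rw [this, indicator_of_mem hp]
      field_simp
    · rw [indicator_of_notMem hp]
      simp [W_out hp]
  simp_rw [e]
  rw [setIntegral_indicator (meas_Sq η), inter_eq_right.2 (Sq_sub h), setIntegral_const, smul_eq_mul,
    mul_comm]
  congr 1
  rw [Sq, Measure.real, Measure.volume_eq_prod, Measure.prod_prod, Real.volume_Icc, ENNReal.toReal_mul,
    ENNReal.toReal_ofReal (by linarith)]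
  ring

def hh (x : ℝ) : ℝ := (x ^ 2)⁻¹ + ((1 - x) ^ 2)⁻¹

lemma hh_cont {η : ℝ} (h : 0 < η) : ContinuousOn hh (Icc η (1 - η)) := by
  unfold hh
  refine ContinuousOn.add (ContinuousOn.inv₀ (by fun_prop) ?_) (ContinuousOn.inv₀ (by fun_prop) ?_)
  · intro x hx
    have := h.trans_le hx.1
    positivity
  · intro x hx
    have : 0 < 1 - x := by linarith [hx.2]
    positivity

lemma hh_int {η : ℝ} (h : 0 < η) (h2 : η < 1 / 2) : ∫ x in Icc η (1 - η), hh x ≤ 2 / η := by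
  rw [integral_Icc_eq_integral_Ioc, ← intervalIntegral.integral_of_le (by linarith),
    intervalIntegral.integral_eq_sub_of_hasDerivAt (f := fun x => -x⁻¹ + (1 - x)⁻¹)]
  · have : 0 < (1 - η)⁻¹ := inv_pos.2 (by linarith)
    have e : (1 : ℝ) - (1 - η) = η := by ring
    simp only [e]
    have : 2 / η = η⁻¹ + η⁻¹ := by ring
    rw [this]
    linarith
  · intro x hx
    rw [uIcc_of_le (by linarith)] at hx
    have h1 : x ≠ 0 := (h.trans_le hx.1).ne'
    have h3 : 1 - x ≠ 0 := by linarith [hx.2]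
    have e1 := (hasDerivAt_inv h1).neg
    have e2 := ((hasDerivAt_id x).const_sub 1).inv h3
    refine (e1.add e2).congr_deriv ?_
    unfold hh
    simp [neg_div]
  · apply ContinuousOn.intervalIntegrable
    rw [uIcc_of_le (by linarith)]
    exact hh_cont h

lemma W_sq_int {η : ℝ} (h : 0 < η) (h2 : η < 1 / 2) :
    ∫ z in Q0 ×ˢ Q0, W η z * W η z ≤ 4 * π / η := by
  have i0 : IntegrableOn (W η) (Q0 ×ˢ Q0) := by
    have := int_W h (F := fun _ => 1) (intQQ continuous_const)
    simpa using this
  have i := int_W h i0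
  have hpi := pi_pos
  have hle : (∫ p in Q0, ∫ q in Q0, W η (p, q) * W η (p, q)) ≤
      ∫ p in Q0, (Sq η).indicator (fun p => π * (hh p.1 * 1 + 1 * hh p.2)) p := by
    have hc : ContinuousOn (fun p : Plane => π * (hh p.1 * 1 + 1 * hh p.2)) (Sq η) := by
      have c1 : ContinuousOn (fun p : Plane => hh p.1) (Sq η) :=
        (hh_cont h).comp continuousOn_fst fun p hp => hp.1
      have c2 : ContinuousOn (fun p : Plane => hh p.2) (Sq η) :=
        (hh_cont h).comp continuousOn_snd fun p hp => hp.2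
      fun_prop
    refine integral_mono ?_ ?_ ?_
    · unfold IntegrableOn at i
      rw [restrQQ] at i
      exact i.integral_prod_left
    · rw [integrable_indicator_iff (meas_Sq η)]
      have : IntegrableOn (fun p : Plane => π * (hh p.1 * 1 + 1 * hh p.2)) (Sq η) :=
        hc.integrableOn_compact (isCompact_Icc.prod isCompact_Icc)
      exact this.mono_measure Measure.restrict_le_self
    · intro p
      simp only
      by_cases hp : p ∈ Sq η
      · have hd : 0 < dd p := h.trans_le (Sq_dd hp)
        rw [W_inner h hp, indicator_of_mem hp]
        have e : ∫ q in disc p (dd p), W η (p, q) = (dd p ^ 2)⁻¹ * (π * dd p ^ 2) := by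
          rw [← disc_area p hd, ← integral_const_mul]
          refine setIntegral_congr_fun (isOpen_disc _ _).measurableSet fun q hq => ?_
          rw [W, indicator_of_mem (show (p, q) ∈ WS η from ⟨hp, hq⟩), mul_one]
        rw [e]
        have e2 : (dd p ^ 2)⁻¹ * ((dd p ^ 2)⁻¹ * (π * dd p ^ 2)) = π * (dd p ^ 2)⁻¹ := by
          field_simp
        rw [e2]
        refine mul_le_mul_of_nonneg_left ?_ hpi.le
        unfold hh
        have n1 : 0 ≤ (p.1 ^ 2)⁻¹ := by positivity
        have n2 : 0 ≤ ((1 - p.1) ^ 2)⁻¹ := by positivity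
        have n3 : 0 ≤ (p.2 ^ 2)⁻¹ := by positivity
        have n4 : 0 ≤ ((1 - p.2) ^ 2)⁻¹ := by positivity
        unfold dd
        rcases min_choice (min p.1 (1 - p.1)) (min p.2 (1 - p.2)) with h1 | h1 <;> rw [h1]
        · rcases min_choice p.1 (1 - p.1) with h1 | h1 <;> rw [h1] <;> linarith
        · rcases min_choice p.2 (1 - p.2) with h1 | h1 <;> rw [h1] <;> linarith
      · rw [indicator_of_notMem hp]
        simp [W_out hp]
  rw [fubQQ i]
  refine hle.trans ?_
  rw [setIntegral_indicator (meas_Sq η), inter_eq_right.2 (Sq_sub h), integral_const_mul, integral_add]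
  · have hH := hh_int h h2
    have hone : ∫ x in Icc η (1 - η), (1:ℝ) = 1 - 2 * η := by
      rw [setIntegral_const, Measure.real, Real.volume_Icc, ENNReal.toReal_ofReal (by linarith)]
      simp; ring
    have hH0 : 0 ≤ ∫ x in Icc η (1 - η), hh x := integral_nonneg fun x => by unfold hh; positivity
    rw [Sq, Measure.volume_eq_prod, setIntegral_prod_mul hh (fun _ => (1:ℝ)),
      setIntegral_prod_mul (fun _ => (1:ℝ)) hh, hone]
    have : (∫ x in Icc η (1 - η), hh x) * (1 - 2 * η) + (1 - 2 * η) * (∫ x in Icc η (1 - η), hh x) ≤ 4 / η := by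
      have e : (4:ℝ) / η = 2 / η + 2 / η := by ring
      rw [e]; nlinarith
    calc _ ≤ π * (4 / η) := mul_le_mul_of_nonneg_left this hpi.le
      _ = _ := by ring
  · have c1 : ContinuousOn (fun p : Plane => hh p.1 * 1) (Sq η) := by
      have : ContinuousOn (fun p : Plane => hh p.1) (Sq η) :=
        (hh_cont h).comp continuousOn_fst fun p hp => hp.1
      fun_prop
    exact c1.integrableOn_compact (isCompact_Icc.prod isCompact_Icc)
  · have c1 : ContinuousOn (fun p : Plane => 1 * hh p.2) (Sq η) := by
      have : ContinuousOn (fun p : Plane => hh p.2) (Sq η) :=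
        (hh_cont h).comp continuousOn_snd fun p hp => hp.2
      fun_prop
    exact c1.integrableOn_compact (isCompact_Icc.prod isCompact_Icc)

lemma diamag_pt (G X : ℂ) (b α : ℝ) (hα : 0 < α) :
    ((1 / (2 * √(‖G‖ ^ 2 + α))) * (2 * (G.re * X.re + G.im * X.im))) ^ 2 ≤
      ‖-Complex.I * X + Complex.ofReal b * G‖ ^ 2 := by
  have hpos : 0 < ‖G‖ ^ 2 + α := by positivity
  have e : ((1 / (2 * √(‖G‖ ^ 2 + α))) * (2 * (G.re * X.re + G.im * X.im))) ^ 2 =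
      (G.re * X.re + G.im * X.im) ^ 2 / (‖G‖ ^ 2 + α) := by
    have := Real.sq_sqrt hpos.le
    have h0 : √(‖G‖ ^ 2 + α) ≠ 0 := (Real.sqrt_pos.2 hpos).ne'
    rw [← this]
    field_simp
    simp [this]
  rw [e, div_le_iff₀ hpos]
  simp only [← Complex.normSq_eq_norm_sq, Complex.normSq_apply]
  simp
  nlinarith [sq_nonneg (G.re * (X.im + b * G.re) + G.im * (-X.re + b * G.im)),
    mul_nonneg hα.le (sq_nonneg (X.im + b * G.re)),
    mul_nonneg hα.le (sq_nonneg (-X.re + b * G.im))]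

lemma diamag {g : Plane → ℂ} (hg : ContDiff ℝ (⊤ : ℕ∞) g) (p q : Plane) {α : ℝ} (hα : 0 < α) :
    fderiv ℝ (fun q => √(‖g q‖ ^ 2 + α)) q (1, 0) ^ 2 + fderiv ℝ (fun q => √(‖g q‖ ^ 2 + α)) q (0, 1) ^ 2
      ≤ dsq α p g q := by
  have hpos : 0 < ‖g q‖ ^ 2 + α := by positivity
  have h1 : HasFDerivAt g (fderiv ℝ g q) q := (hg.differentiable (by simp) _).hasFDerivAt
  have h2 := ((h1.norm_sq).add_const α).sqrt hpos.ne'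
  rw [h2.fderiv]
  unfold dsq
  refine add_le_add ?_ ?_
  · refine le_trans (le_of_eq ?_) (diamag_pt (g q) (fderiv ℝ g q (1,0)) _ α hα)
    simp [Complex.inner]
    ring
  · refine le_trans (le_of_eq ?_) (diamag_pt (g q) (fderiv ℝ g q (0,1)) _ α hα)
    simp [Complex.inner]
    ring

lemma diamag_smooth {g : Plane → ℂ} (hg : ContDiff ℝ (⊤ : ℕ∞) g) {α : ℝ} (hα : 0 < α) :
    ContDiff ℝ 1 (fun q => √(‖g q‖ ^ 2 + α)) := by
  have h1 : ContDiff ℝ 1 g := hg.of_le (by exact_mod_cast le_top)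
  refine ContDiff.sqrt ?_ ?_
  · exact (h1.norm_sq ℝ).add contDiff_const
  · intro q; positivity

lemma slice_cont {F : Plane × Plane → ℝ} (hF : Continuous F) (p : Plane) :
    Continuous fun q => F (p, q) := hF.comp (Continuous.prodMk_right p)

lemma W_dyson {Ψ : Config 2 → ℂ} (h : Admissible 2 Ψ) {α : ℝ} (h0 : 0 < α) (h1 : α * (4 * π) ≤ 1)
    {η : ℝ} (hη : 0 < η) :
    ∫ z in Q0 ×ˢ Q0, W η z * ‖Ψ ![z.1, z.2]‖ ^ 2 ≤
      (1 / (2 * α)) * ∫ z in Q0 ×ˢ Q0, dsq α z.1 (fun q => Ψ ![z.1, q]) z.2 := by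
  have cΨ := cont_two h.smooth.continuous
  have i1 := int_W hη (F := fun z : Plane × Plane => ‖Ψ ![z.1, z.2]‖ ^ 2) (intQQ (cΨ.norm.pow 2))
  have i2 : IntegrableOn (fun z : Plane × Plane => (1 / (2 * α)) * dsq α z.1 (fun q => Ψ ![z.1, q]) z.2)
      (Q0 ×ˢ Q0) := intQQ (continuous_const.mul (cont_dsq2 h α))
  rw [← integral_const_mul, fubQQ i1, fubQQ i2]
  have n0 : ∀ p, 0 ≤ ∫ q in Q0, (1 / (2 * α)) * dsq α p (fun q => Ψ ![p, q]) q := fun p =>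
    integral_nonneg fun q => mul_nonneg (by positivity) (dsq_nonneg _ _ _ _)
  refine integral_mono ?_ ?_ ?_
  · unfold IntegrableOn at i1
    rw [restrQQ] at i1
    exact i1.integral_prod_left
  · unfold IntegrableOn at i2
    rw [restrQQ] at i2
    exact i2.integral_prod_left
  intro p
  by_cases hp : p ∈ Sq η
  · have hd : 0 < dd p := hη.trans_le (Sq_dd hp)
    have hz : ∀ᶠ q in 𝓝 p, Ψ ![p, q] = 0 := by
      have := adm_zero h (p, p) (by simp)
      have hc : Filter.Tendsto (fun q : Plane => (p, q)) (𝓝 p) (𝓝 (p, p)) :=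
        (Continuous.prodMk_right p).tendsto p
      exact hc.eventually this
    have hdy := dyson (slice_smooth h.smooth p) p hz h0 h1 hd
    have hcs : Continuous fun q => dsq α p (fun q => Ψ ![p, q]) q :=
      slice_cont (cont_dsq2 h α) p
    have hi : IntegrableOn (fun q => dsq α p (fun q => Ψ ![p, q]) q) Q0 := by
      refine (hcs.continuousOn.integrableOn_compact (isCompact_Icc.prod isCompact_Icc :
        IsCompact (Icc (0:ℝ) 1 ×ˢ Icc (0:ℝ) 1))).mono_set ?_
      exact prod_mono Ioo_subset_Icc_self Ioo_subset_Icc_self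
    have hm : ∫ q in disc p (dd p), dsq α p (fun q => Ψ ![p, q]) q ≤
        ∫ q in Q0, dsq α p (fun q => Ψ ![p, q]) q :=
      setIntegral_mono_set hi (Filter.Eventually.of_forall fun q => dsq_nonneg _ _ _ _)
        (disc_sub hd).eventuallyLE
    change ∫ q in Q0, W η (p, q) * ‖Ψ ![p, q]‖ ^ 2 ≤ ∫ q in Q0, (1 / (2 * α)) * dsq α p (fun q => Ψ ![p, q]) q
    rw [W_inner hη hp (fun q => ‖Ψ ![p, q]‖ ^ 2), integral_const_mul]
    have := mul_le_mul_of_nonneg_left (hdy.trans hm) (show 0 ≤ 1 / (2 * α) by positivity)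
    refine le_trans (le_of_eq ?_) this
    field_simp
  · refine le_trans (le_of_eq ?_) (n0 p)
    simp [W_out hp]

set_option maxHeartbeats 1000000 in
lemma lower {Ψ : Config 2 → ℂ} (h : Admissible 2 Ψ) (hn : normSq 2 Q0 Ψ = 1) {a : ℝ} (ha : 0 < a)
    (ha1 : a ≤ 1 / 10) : 4 * π * a ^ 3 * (1 - 60 * a) ≤ kinE 2 (a ^ 3) Q0 Ψ := by
  have hpi := pi_pos
  have hpi3 := pi_gt_three
  have hpi4 := pi_lt_d2
  set α := a ^ 3 with hαd
  have hα : 0 < α := by positivity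
  have ha2 : a ^ 2 ≤ 1 / 100 := by nlinarith
  have hα2 : α ≤ a / 100 := by rw [hαd]; nlinarith
  rw [kinE_eq h α]
  rw [normSq_eq] at hn
  set J := ∫ z in Q0 ×ˢ Q0, dsq α z.1 (fun q => Ψ ![z.1, q]) z.2 with hJ
  have hJ0 : 0 ≤ J := integral_nonneg fun z => dsq_nonneg _ _ _ _
  by_cases hK : 4 * π * α ≤ 2 * J
  · refine le_trans ?_ hK
    have : 0 ≤ 4 * π * α := by positivity
    nlinarith
  push Not at hK
  have cΨ := cont_two h.smooth.continuous
  set u : Plane × Plane → ℝ := fun z => √(‖Ψ ![z.1, z.2]‖ ^ 2 + α) with hu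
  have cu : Continuous u := Real.continuous_sqrt.comp ((cΨ.norm.pow 2).add continuous_const)
  have hu2 : ∀ z, u z ^ 2 = ‖Ψ ![z.1, z.2]‖ ^ 2 + α := fun z => Real.sq_sqrt (by positivity)
  have hp := poinc_real (u := u) (D := fun z => dsq α z.1 (fun q => Ψ ![z.1, q]) z.2) cu
    (fun p q => by simp only [hu, adm_symm h p q]) (fun p => diamag_smooth (slice_smooth h.smooth p) hα)
    (cont_dsq2 h α) (fun p q => diamag (slice_smooth h.smooth p) p q hα)
  rw [← hJ] at hp
  have i2 : IntegrableOn (fun z => ‖Ψ ![z.1, z.2]‖ ^ 2) (Q0 ×ˢ Q0) := intQQ (cΨ.norm.pow 2)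
  have hone : ∀ k : ℝ, ∫ z in Q0 ×ˢ Q0, k = k := fun k => by simp
  have hc2 : ∫ z in Q0 ×ˢ Q0, u z ^ 2 = 1 + α := by
    simp_rw [hu2]
    rw [integral_add i2 (intQQ continuous_const), hn, hone]
  rw [hc2] at hp
  set c := ∫ z in Q0 ×ˢ Q0, u z with hc
  have hc0 : 0 ≤ c := integral_nonneg fun z => Real.sqrt_nonneg _
  have hvar : ∫ z in Q0 ×ˢ Q0, (u z - c) ^ 2 = 1 + α - c ^ 2 := by
    have e : ∀ z, (u z - c) ^ 2 = u z ^ 2 - (2 * c) * u z + c ^ 2 := fun z => by ring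
    simp_rw [e]
    have j1 : IntegrableOn (fun z => u z ^ 2) (Q0 ×ˢ Q0) := intQQ (cu.pow 2)
    have j2 : IntegrableOn (fun z => (2 * c) * u z) (Q0 ×ˢ Q0) := intQQ (continuous_const.mul cu)
    have j3 : IntegrableOn (fun z => u z ^ 2 - (2 * c) * u z) (Q0 ×ˢ Q0) := j1.sub j2
    rw [integral_add j3 (intQQ continuous_const), integral_sub j1 j2, hc2, hone, integral_const_mul, ← hc]
    ring
  have hvar0 : 0 ≤ ∫ z in Q0 ×ˢ Q0, (u z - c) ^ 2 := integral_nonneg fun z => sq_nonneg _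
  have hcle : c ≤ 2 := by nlinarith
  have hWd := W_dyson h hα (by nlinarith) ha
  rw [← hJ] at hWd
  have iW : IntegrableOn (W a) (Q0 ×ˢ Q0) := by
    have := int_W ha (F := fun _ => 1) (intQQ continuous_const)
    simpa using this
  have iWW := int_W ha iW
  have iWP := int_W ha i2
  have hpt : ∀ z, W a z * (c ^ 2 - α) - c * (a ^ 2 * (W a z * W a z) + (1 / a ^ 2) * (u z - c) ^ 2) ≤
      W a z * ‖Ψ ![z.1, z.2]‖ ^ 2 := by
    intro z
    have e1 : ‖Ψ ![z.1, z.2]‖ ^ 2 = u z ^ 2 - α := by rw [hu2]; ring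
    rw [e1]
    have hw := W_nonneg a z
    have k1 : W a z * (2 * c * u z - c ^ 2) ≤ W a z * u z ^ 2 :=
      mul_le_mul_of_nonneg_left (by nlinarith [sq_nonneg (u z - c)]) hw
    have k2 : 0 ≤ c * (a * W a z + (1 / a) * (u z - c)) ^ 2 := by positivity
    have k3 : c * (a * W a z + (1 / a) * (u z - c)) ^ 2 =
        c * (a ^ 2 * (W a z * W a z) + (1 / a ^ 2) * (u z - c) ^ 2) + 2 * c * W a z * (u z - c) := by
      field_simp; ring
    nlinarith
  have iu : IntegrableOn (fun z => (1 / a ^ 2) * (u z - c) ^ 2) (Q0 ×ˢ Q0) := intQQ (by fun_prop)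
  have hint := integral_mono (μ := volume.restrict (Q0 ×ˢ Q0))
    ((iW.mul_const (c ^ 2 - α)).sub (((iWW.const_mul (a ^ 2)).add iu).const_mul c)) iWP hpt
  have hint' : (∫ z in Q0 ×ˢ Q0, W a z) * (c ^ 2 - α) - c * (a ^ 2 * (∫ z in Q0 ×ˢ Q0, W a z * W a z)
      + (1 / a ^ 2) * ∫ z in Q0 ×ˢ Q0, (u z - c) ^ 2) ≤ ∫ z in Q0 ×ˢ Q0, W a z * ‖Ψ ![z.1, z.2]‖ ^ 2 := by
    refine le_trans (le_of_eq ?_) hint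
    rw [← integral_mul_const, ← integral_const_mul (a ^ 2), ← integral_const_mul (1 / a ^ 2),
      ← integral_add (iWW.const_mul (a ^ 2)) iu, ← integral_const_mul c, ← integral_sub]
    · rfl
    · exact iW.mul_const _
    · exact ((iWW.const_mul (a ^ 2)).add iu).const_mul c
  rw [W_int ha (by linarith), hvar] at hint'
  have hWs := W_sq_int ha (by linarith)
  have b1 : a ^ 2 * (∫ z in Q0 ×ˢ Q0, W a z * W a z) ≤ 4 * π * a := by
    refine (mul_le_mul_of_nonneg_left hWs (sq_nonneg a)).trans (le_of_eq ?_)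
    field_simp
  have b2 : (1 / a ^ 2) * (1 + α - c ^ 2) ≤ 8 * π * a := by
    have : 1 + α - c ^ 2 ≤ 8 * π * α := by linarith
    refine (mul_le_mul_of_nonneg_left this (by positivity)).trans (le_of_eq ?_)
    rw [hαd]; field_simp
  have b3 : c * (a ^ 2 * (∫ z in Q0 ×ˢ Q0, W a z * W a z) + (1 / a ^ 2) * (1 + α - c ^ 2)) ≤ 2 * (12 * π * a) := by
    refine (mul_le_mul_of_nonneg_left (add_le_add b1 b2) hc0).trans ?_
    have : 0 ≤ π * a := by positivity
    have k := mul_le_mul_of_nonneg_right hcle this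
    have k2 : c * (4 * π * a + 8 * π * a) = 12 * (c * (π * a)) := by ring
    rw [k2]; linarith
  have b4 : 1 - a ≤ c ^ 2 - α := by
    have : π * α ≤ 4 * α := mul_le_mul_of_nonneg_right (by linarith) hα.le
    have : 8 * π * α ≤ a := by linarith
    linarith
  have b5 : π * (1 - 5 * a) ≤ π * (1 - 2 * a) ^ 2 * (c ^ 2 - α) := by
    rw [mul_assoc]
    refine mul_le_mul_of_nonneg_left ?_ hpi.le
    have := mul_le_mul_of_nonneg_left b4 (sq_nonneg (1 - 2 * a))
    refine le_trans ?_ this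
    nlinarith only [ha, ha1, ha2, mul_nonneg ha.le (sub_nonneg.2 ha1), mul_nonneg (sq_nonneg a) (sub_nonneg.2 ha1)]
  have b6 : π * (1 - 5 * a) - 24 * π * a ≤ 1 / (2 * α) * J := by linarith
  have b7 := mul_le_mul_of_nonneg_left b6 (show 0 ≤ 4 * α by positivity)
  have b8 : 4 * α * (1 / (2 * α) * J) = 2 * J := by field_simp; ring
  rw [b8] at b7
  have b9 : 0 ≤ π * α * a := by positivity
  nlinarith only [b7, b9]

lemma polar_le {p : Plane} (hp : p ∈ Q0) {F : Plane → ℝ} (hF : Continuous F) (hF0 : ∀ q, 0 ≤ F q)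
    {B : ℝ → ℝ} (hB : IntervalIntegrable B volume 0 √2)
    (hb : ∀ r, 0 < r → r ≤ √2 → ∀ φ, r * F (ray p r φ) ≤ B r) :
    ∫ q in Q0, F q ≤ 2 * π * ∫ r in (0:ℝ)..√2, B r := by
  have hpi := pi_pos
  have h2 : 0 < √(2:ℝ) := by positivity
  have hsq : √(2:ℝ) ^ 2 = 2 := Real.sq_sqrt (by norm_num)
  have hsub : Q0 ⊆ disc p √2 := by
    rintro q ⟨⟨a1, a2⟩, ⟨a3, a4⟩⟩
    obtain ⟨⟨b1, b2⟩, ⟨b3, b4⟩⟩ := hp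
    show (q.1 - p.1) ^ 2 + (q.2 - p.2) ^ 2 < √2 ^ 2
    rw [hsq]
    nlinarith
  have hi : IntegrableOn F (disc p √2) := by
    refine (hF.continuousOn.integrableOn_compact (isCompact_Icc.prod isCompact_Icc :
        IsCompact (Icc (p.1 - √2) (p.1 + √2) ×ˢ Icc (p.2 - √2) (p.2 + √2)))).mono_set ?_
    intro q hq
    have hq' : (q.1 - p.1) ^ 2 + (q.2 - p.2) ^ 2 < √2 ^ 2 := hq
    have a1 : |q.1 - p.1| < √2 := abs_lt_of_sq_lt_sq (by nlinarith [sq_nonneg (q.2 - p.2)]) h2.le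
    have a2 : |q.2 - p.2| < √2 := abs_lt_of_sq_lt_sq (by nlinarith [sq_nonneg (q.1 - p.1)]) h2.le
    rw [abs_lt] at a1 a2
    exact ⟨⟨by linarith, by linarith⟩, ⟨by linarith, by linarith⟩⟩
  refine (setIntegral_mono_set hi (Filter.Eventually.of_forall hF0) hsub.eventuallyLE).trans ?_
  rw [polar_disc p h2 hF, ← intervalIntegral.integral_const_mul]
  have hc : Continuous (fun z : ℝ × ℝ => z.1 * F (ray p z.1 z.2)) :=
    continuous_fst.mul (hF.comp (ray_continuous p))
  refine intervalIntegral.integral_mono_on_of_le_Ioo h2.le ?_ (hB.const_mul _) ?_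
  · refine Continuous.intervalIntegrable ?_ _ _
    exact intervalIntegral.continuous_parametric_intervalIntegral_of_continuous' hc _ _
  · intro r hr
    have : ∫ φ in (-π)..π, r * F (ray p r φ) ≤ ∫ φ in (-π)..π, B r := by
      refine intervalIntegral.integral_mono_on (by linarith) ?_ (by simp) (fun φ _ => hb r hr.1 hr.2.le φ)
      exact (hc.comp (by fun_prop : Continuous fun φ : ℝ => (r, φ))).intervalIntegrable _ _
    refine this.trans (le_of_eq ?_)
    rw [intervalIntegral.integral_const, smul_eq_mul]; ring

/-- smooth truncation -/
def th (ε u : ℝ) : ℝ := ∫ s in (0:ℝ)..u, smoothTransition ((s - ε) / ε)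

lemma th_cont (ε : ℝ) : Continuous fun s => smoothTransition ((s - ε) / ε) :=
  smoothTransition.continuous.comp (by fun_prop)

lemma th_deriv (ε u : ℝ) : HasDerivAt (th ε) (smoothTransition ((u - ε) / ε)) u :=
  (th_cont ε).integral_hasStrictDerivAt 0 u |>.hasDerivAt

lemma th_smooth (ε : ℝ) : ContDiff ℝ (⊤ : ℕ∞) (th ε) := by
  refine contDiff_infty_iff_deriv.2 ⟨fun u => (th_deriv ε u).differentiableAt, ?_⟩
  have : deriv (th ε) = fun u => smoothTransition ((u - ε) / ε) := funext fun u => (th_deriv ε u).deriv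
  rw [this]
  refine smoothTransition.contDiff.comp ?_
  fun_prop

lemma th_zero {ε : ℝ} (hε : 0 < ε) {u : ℝ} (hu : u ≤ ε) : th ε u = 0 := by
  unfold th
  have : ∀ s ∈ uIcc 0 u, smoothTransition ((s - ε) / ε) = (fun _ => (0:ℝ)) s := by
    intro s hs
    refine smoothTransition.zero_of_nonpos ?_
    have : s ≤ ε := hs.2.trans (sup_le hε.le hu)
    exact div_nonpos_of_nonpos_of_nonneg (by linarith) hε.le
  rw [intervalIntegral.integral_congr this]
  simp

lemma th_nonneg (ε : ℝ) {u : ℝ} (hu : 0 ≤ u) : 0 ≤ th ε u :=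
  intervalIntegral.integral_nonneg hu fun _ _ => smoothTransition.nonneg _

lemma th_le (ε : ℝ) {u : ℝ} (hu : 0 ≤ u) : th ε u ≤ u := by
  have : th ε u ≤ ∫ s in (0:ℝ)..u, (1:ℝ) :=
    intervalIntegral.integral_mono_on hu ((th_cont ε).intervalIntegrable _ _) (by simp)
      fun _ _ => smoothTransition.le_one _
  simpa using this

lemma th_ge {ε : ℝ} (hε : 0 < ε) {u : ℝ} (hu : 0 ≤ u) : u - 2 * ε ≤ th ε u := by
  rcases le_total u (2 * ε) with h | h
  · have := th_nonneg ε hu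
    linarith
  · have e : th ε u = th ε (2 * ε) + ∫ s in (2 * ε)..u, smoothTransition ((s - ε) / ε) :=
      (intervalIntegral.integral_add_adjacent_intervals ((th_cont ε).intervalIntegrable _ _)
        ((th_cont ε).intervalIntegrable _ _)).symm
    have e2 : ∫ s in (2 * ε)..u, smoothTransition ((s - ε) / ε) = ∫ s in (2 * ε)..u, (1:ℝ) := by
      refine intervalIntegral.integral_congr fun s hs => ?_
      rw [uIcc_of_le h] at hs
      refine smoothTransition.one_of_one_le ?_
      rw [le_div_iff₀ hε]
      linarith [hs.1]
    have := th_nonneg ε (u := 2 * ε) (by positivity)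
    rw [e, e2]
    simp
    linarith

/-- radial profile -/
def Th (κ α s : ℝ) : ℝ := κ * th α (s ^ (α / 2))

lemma Th_zero (κ : ℝ) {α : ℝ} (hα : 0 < α) : ∀ᶠ s in 𝓝 (0:ℝ), Th κ α s = 0 := by
  have hc : ContinuousAt (fun s : ℝ => s ^ (α / 2)) 0 :=
    (Real.continuous_rpow_const (by positivity)).continuousAt
  have h0 : (0:ℝ) ^ (α / 2) < α := by rw [Real.zero_rpow (by positivity)]; exact hα
  filter_upwards [hc.eventually (gt_mem_nhds h0)] with s hs
  rw [Th, th_zero hα (le_of_lt hs), mul_zero]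

lemma Th_smooth (κ : ℝ) {α : ℝ} (hα : 0 < α) : ContDiff ℝ (⊤ : ℕ∞) (Th κ α) := by
  rw [contDiff_iff_contDiffAt]
  intro s
  by_cases hs : s = 0
  · rw [hs]
    have : ContDiffAt ℝ (⊤ : ℕ∞) (fun _ : ℝ => (0:ℝ)) 0 := contDiffAt_const
    exact this.congr_of_eventuallyEq (Th_zero κ hα)
  · unfold Th
    refine contDiffAt_const.mul ?_
    exact ((th_smooth α).contDiffAt).comp s (contDiffAt_rpow_const_of_ne hs)

lemma Th_deriv (κ : ℝ) {α : ℝ} {s : ℝ} (hs : 0 < s) : HasDerivAt (Th κ α)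
    (κ * (smoothTransition ((s ^ (α / 2) - α) / α) * (α / 2 * s ^ (α / 2 - 1)))) s := by
  have h1 : HasDerivAt (fun x : ℝ => x ^ (α / 2)) (α / 2 * s ^ (α / 2 - 1)) s :=
    Real.hasDerivAt_rpow_const (Or.inl hs.ne')
  exact ((th_deriv α _).comp s h1).const_mul κ

def rho (x : Config 2) : ℝ := ((x 1).1 - (x 0).1) ^ 2 + ((x 1).2 - (x 0).2) ^ 2

def Gf (Θ : ℝ → ℝ) (x : Config 2) : ℂ := Complex.ofReal (Θ (rho x))

lemma adm_Gf {Θ : ℝ → ℝ} (hΘ : ContDiff ℝ (⊤ : ℕ∞) Θ) (hz : ∀ᶠ s in 𝓝 (0:ℝ), Θ s = 0) :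
    Admissible 2 (Gf Θ) := by
  have hr : ContDiff ℝ (⊤ : ℕ∞) rho := by unfold rho; fun_prop
  refine ⟨?_, ?_, ?_⟩
  · exact Complex.ofRealCLM.contDiff.comp (hΘ.comp hr)
  · intro σ x
    have hσ : (σ 0 = 0 ∧ σ 1 = 1) ∨ (σ 0 = 1 ∧ σ 1 = 0) := by revert σ; decide
    have : rho (x ∘ σ) = rho x := by
      rcases hσ with h | h <;> simp only [rho, Function.comp, h.1, h.2] <;> ring
    simp only [Gf, this]
  · refine ⟨rho ⁻¹' interior {s | Θ s = 0}, isOpen_interior.preimage hr.continuous, ?_, ?_⟩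
    · rintro x ⟨j, k, hjk, hx⟩
      have : x 0 = x 1 := by
        fin_cases j <;> fin_cases k <;> simp_all
      have hr0 : rho x = 0 := by simp [rho, this]
      show rho x ∈ interior {s | Θ s = 0}
      rw [hr0, mem_interior_iff_mem_nhds]
      exact hz
    · intro x hx
      have hx' : rho x ∈ {s | Θ s = 0} := interior_subset hx
      have : Θ (rho x) = 0 := hx'
      simp [Gf, this]

lemma Gf_two (Θ : ℝ → ℝ) (p q : Plane) :
    Gf Θ ![p, q] = Complex.ofReal (Θ ((q.1 - p.1) ^ 2 + (q.2 - p.2) ^ 2)) := by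
  simp [Gf, rho]

lemma real_norm (a b c : ℝ) : ‖-Complex.I * Complex.ofReal a + Complex.ofReal b * Complex.ofReal c‖ ^ 2
    = a ^ 2 + (b * c) ^ 2 := by
  simp only [← Complex.normSq_eq_norm_sq, Complex.normSq_apply]
  simp
  ring

lemma dsq_Gf {Θ : ℝ → ℝ} {Θ' : ℝ} (α : ℝ) (p : Plane) {r : ℝ} (hr : 0 < r) (φ : ℝ)
    (hΘ : HasDerivAt Θ Θ' (r ^ 2)) :
    dsq α p (fun q => Gf Θ ![p, q]) (ray p r φ) = 4 * r ^ 2 * Θ' ^ 2 + α ^ 2 * Θ (r ^ 2) ^ 2 / r ^ 2 := by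
  have h := sin_sq_add_cos_sq φ
  have er : ((ray p r φ).1 - p.1) ^ 2 + ((ray p r φ).2 - p.2) ^ 2 = r ^ 2 := by
    simp only [ray]; linear_combination r ^ 2 * h
  have hf : HasFDerivAt (fun q : Plane => (q.1 - p.1) ^ 2 + (q.2 - p.2) ^ 2)
      ((2 * ((ray p r φ).1 - p.1)) • ContinuousLinearMap.fst ℝ ℝ ℝ +
       (2 * ((ray p r φ).2 - p.2)) • ContinuousLinearMap.snd ℝ ℝ ℝ) (ray p r φ) := by
    have h1 := ((hasFDerivAt_fst (𝕜 := ℝ) (p := ray p r φ)).sub_const p.1).pow 2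
    have h2 := ((hasFDerivAt_snd (𝕜 := ℝ) (p := ray p r φ)).sub_const p.2).pow 2
    refine (h1.add h2).congr_fderiv ?_
    ext <;> simp
  rw [← er] at hΘ
  have hg0 := HasDerivAt.comp_hasFDerivAt (f := fun q : Plane => (q.1 - p.1) ^ 2 + (q.2 - p.2) ^ 2)
    (ray p r φ) hΘ hf
  have hg := (Complex.ofRealCLM.hasFDerivAt (x := Θ (((ray p r φ).1 - p.1) ^ 2 + ((ray p r φ).2 - p.2) ^ 2))).comp
    (ray p r φ) hg0
  have e : (fun q => Gf Θ ![p, q]) = (fun q : Plane => Complex.ofReal (Θ ((q.1 - p.1) ^ 2 + (q.2 - p.2) ^ 2))) :=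
    funext fun q => Gf_two Θ p q
  have hg' : fderiv ℝ (fun q => Gf Θ ![p, q]) (ray p r φ) =
      Complex.ofRealCLM.comp (Θ' • ((2 * ((ray p r φ).1 - p.1)) • ContinuousLinearMap.fst ℝ ℝ ℝ +
        (2 * ((ray p r φ).2 - p.2)) • ContinuousLinearMap.snd ℝ ℝ ℝ)) := by
    rw [e]; exact hg.fderiv
  have d1 : fderiv ℝ (fun q => Gf Θ ![p, q]) (ray p r φ) (1, 0) = Complex.ofReal (Θ' * (2 * (r * cos φ))) := by
    rw [hg']; simp [ray]
  have d2 : fderiv ℝ (fun q => Gf Θ ![p, q]) (ray p r φ) (0, 1) = Complex.ofReal (Θ' * (2 * (r * sin φ))) := by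
    rw [hg']; simp [ray]
  rw [dsq, d1, d2, perpInv_ray p hr.ne']
  simp only [Gf_two, er]
  rw [real_norm, real_norm]
  field_simp
  linear_combination (4 * r ^ 4 * Θ' ^ 2 + α ^ 2 * Θ (r ^ 2) ^ 2) * h

lemma sqQ {F : Plane × Plane → ℝ} (hF : Continuous F) {M : ℝ} (h : ∀ p ∈ Q0, ∫ q in Q0, F (p, q) ≤ M) :
    ∫ z in Q0 ×ˢ Q0, F z ≤ M := by
  have i : IntegrableOn F (Q0 ×ˢ Q0) := intQQ hF
  rw [fubQQ i]
  have hM : ∫ _p in Q0, M = M := by simp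
  refine le_trans ?_ hM.le
  refine setIntegral_mono_on ?_ (integrable_const (μ := volume.restrict Q0) M) measQ h
  unfold IntegrableOn at i
  rw [restrQQ] at i
  exact i.integral_prod_left

lemma rpow_sq_half {r : ℝ} (hr : 0 < r) (β : ℝ) : (r ^ 2) ^ (β / 2) = r ^ β := by
  rw [← Real.rpow_natCast, ← Real.rpow_mul hr.le]
  congr 1
  push_cast
  ring

lemma kin_up {κ α : ℝ} (hκ : 0 < κ) (hα : 0 < α) (hα1 : α ≤ 1) :
    kinE 2 α Q0 (Gf (Th κ α)) ≤ 4 * π * α * κ ^ 2 * (1 + α) := by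
  have hpi := pi_pos
  have hadm := adm_Gf (Th_smooth κ hα) (Th_zero κ hα)
  rw [kinE_eq hadm]
  have hcd := cont_dsq2 hadm α
  have h2 : √(2:ℝ) ^ (2 * α) ≤ 1 + α := by
    have := rpow_one_add_le_one_add_mul_self (s := 1) (by norm_num) hα.le hα1
    have e : √(2:ℝ) ^ (2 * α) = (1 + 1) ^ α := by
      rw [Real.rpow_mul (by positivity)]
      norm_num
    rw [e]; linarith
  have key : ∀ p ∈ Q0, ∫ q in Q0, dsq α p (fun q => Gf (Th κ α) ![p, q]) q ≤
      2 * π * (κ ^ 2 * α * (1 + α)) := by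
    intro p hp
    have hB : IntervalIntegrable (fun r : ℝ => 2 * κ ^ 2 * α ^ 2 * r ^ (2 * α - 1)) volume 0 √2 :=
      (intervalIntegral.intervalIntegrable_rpow' (by linarith)).const_mul _
    refine (polar_le hp (slice_cont hcd p) (fun q => dsq_nonneg _ _ _ _) hB ?_).trans ?_
    · intro r hr _ φ
      show r * dsq α p (fun q => Gf (Th κ α) ![p, q]) (ray p r φ) ≤ _
      rw [dsq_Gf α p hr φ (Th_deriv κ (by positivity))]
      have e1 : (r ^ 2) ^ (α / 2 - 1) = r ^ α / r ^ 2 := by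
        rw [Real.rpow_sub (by positivity), rpow_sq_half hr, Real.rpow_one]
      rw [Th, rpow_sq_half hr, e1]
      have e2 : r ^ (2 * α - 1) = (r ^ α) ^ 2 / r := by
        rw [Real.rpow_sub hr, Real.rpow_one, two_mul, Real.rpow_add hr, sq]
      rw [e2]
      set R := r ^ α with hR
      have hR0 : 0 < R := Real.rpow_pos_of_pos hr _
      set S := smoothTransition ((R - α) / α)
      have hS0 : 0 ≤ S := smoothTransition.nonneg _
      have hS1 : S ≤ 1 := smoothTransition.le_one _
      have t0 := th_nonneg α hR0.le
      have t1 := th_le α hR0.le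
      set T := th α R
      have hS : S ^ 2 ≤ 1 := by nlinarith
      have hT : T ^ 2 ≤ R ^ 2 := by gcongr
      have e3 : r * (4 * r ^ 2 * (κ * (S * (α / 2 * (R / r ^ 2)))) ^ 2 + α ^ 2 * (κ * T) ^ 2 / r ^ 2) =
          (κ ^ 2 * α ^ 2 / r) * (S ^ 2 * R ^ 2 + T ^ 2) := by
        field_simp
        ring
      have e4 : 2 * κ ^ 2 * α ^ 2 * (R ^ 2 / r) = (κ ^ 2 * α ^ 2 / r) * (1 * R ^ 2 + R ^ 2) := by
        field_simp
        ring
      rw [e3, e4]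
      gcongr
    · rw [intervalIntegral.integral_const_mul, integral_rpow (Or.inl (by linarith))]
      have e : 2 * α - 1 + 1 = 2 * α := by ring
      rw [e, Real.zero_rpow (by positivity), sub_zero]
      have e5 : 2 * κ ^ 2 * α ^ 2 * (√2 ^ (2 * α) / (2 * α)) = κ ^ 2 * α * √2 ^ (2 * α) := by
        field_simp
      rw [e5]
      gcongr
  have := sqQ hcd key
  calc _ ≤ 2 * (2 * π * (κ ^ 2 * α * (1 + α))) := mul_le_mul_of_nonneg_left this (by norm_num)
    _ = _ := by ring

lemma norm_low {α : ℝ} (hα : 0 < α) : 1 - 80 * α ≤ normSq 2 Q0 (Gf (Th 1 α)) := by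
  have hpi := pi_pos
  have hpi4 := pi_lt_d2
  have hadm := adm_Gf (Th_smooth 1 hα) (Th_zero 1 hα)
  have hs2 : √(2:ℝ) ≤ 3 / 2 := by
    rw [Real.sqrt_le_left (by norm_num)]; norm_num
  rw [normSq_eq]
  set F : Plane × Plane → ℝ := fun z => max (1 - (Gf (Th 1 α) ![z.1, z.2]).re) 0 with hF
  have cG := cont_two hadm.smooth.continuous
  have cF : Continuous F := by
    refine Continuous.max (continuous_const.sub (Complex.continuous_re.comp cG)) continuous_const
  have key : ∀ p ∈ Q0, ∫ q in Q0, F (p, q) ≤ 40 * α := by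
    intro p hp
    refine (polar_le hp (slice_cont cF p) (fun q => le_max_right _ _) (B := fun _ => 4 * α) (by simp) ?_).trans ?_
    · intro r hr hr2 φ
      have er : ((ray p r φ).1 - p.1) ^ 2 + ((ray p r φ).2 - p.2) ^ 2 = r ^ 2 := by
        simp only [ray]; linear_combination r ^ 2 * sin_sq_add_cos_sq φ
      simp only [hF, Gf_two, er, Complex.ofReal_re, Th, rpow_sq_half hr, one_mul]
      have hR0 : 0 < r ^ α := Real.rpow_pos_of_pos hr _
      have t1 := th_ge hα hR0.le
      have t2 : 1 + α * Real.log r ≤ r ^ α := by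
        rw [Real.rpow_def_of_pos hr]
        have := Real.add_one_le_exp (Real.log r * α)
        linarith
      have t3 : 1 - r⁻¹ ≤ Real.log r := Real.one_sub_inv_le_log_of_pos hr
      have t4 : 1 - th α (r ^ α) ≤ α * r⁻¹ + 2 * α := by nlinarith
      have t5 : max (1 - th α (r ^ α)) 0 ≤ α * r⁻¹ + 2 * α := max_le t4 (by positivity)
      calc r * max (1 - th α (r ^ α)) 0 ≤ r * (α * r⁻¹ + 2 * α) := mul_le_mul_of_nonneg_left t5 hr.le
        _ = α + 2 * α * r := by field_simp
        _ ≤ 4 * α := by nlinarith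
    · rw [intervalIntegral.integral_const, smul_eq_mul, sub_zero]
      have : 2 * π * (√2 * (4 * α)) ≤ 2 * 3.15 * (3 / 2 * (4 * α)) := by gcongr
      linarith
  have h1 := sqQ cF key
  have cN : Continuous fun z : Plane × Plane => ‖Gf (Th 1 α) ![z.1, z.2]‖ ^ 2 := cG.norm.pow 2
  have c1 : Continuous fun z => 1 - 2 * F z := by fun_prop
  have h2 : ∫ z in Q0 ×ˢ Q0, (1 - 2 * F z) ≤ ∫ z in Q0 ×ˢ Q0, ‖Gf (Th 1 α) ![z.1, z.2]‖ ^ 2 := by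
    refine integral_mono (intQQ c1) (intQQ cN) fun z => ?_
    simp only [hF, Gf_two, Complex.norm_real, norm_eq_abs, sq_abs, Complex.ofReal_re]
    set x := Th 1 α ((z.2.1 - z.1.1) ^ 2 + (z.2.2 - z.1.2) ^ 2)
    have := le_max_left (1 - x) 0
    nlinarith [sq_nonneg (x - 1)]
  refine le_trans ?_ h2
  rw [integral_sub (intQQ continuous_const) (intQQ (by fun_prop)), integral_const_mul]
  have : ∫ z in Q0 ×ˢ Q0, (1:ℝ) = 1 := by simp
  rw [this]
  linarith

lemma norm_scale (κ α : ℝ) : normSq 2 Q0 (Gf (Th κ α)) = κ ^ 2 * normSq 2 Q0 (Gf (Th 1 α)) := by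
  unfold normSq
  rw [← integral_const_mul]
  congr 1
  funext x
  simp only [Gf, Complex.norm_real, norm_eq_abs, sq_abs, Th]
  ring

lemma upper {α : ℝ} (hα : 0 < α) (hα1 : α ≤ 1 / 1000) : ∃ Ψ : Config 2 → ℂ, Admissible 2 Ψ ∧
    normSq 2 Q0 Ψ = 1 ∧ kinE 2 α Q0 Ψ ≤ 4 * π * α * (1 + 100 * α) := by
  have hn := norm_low hα
  set n := normSq 2 Q0 (Gf (Th 1 α)) with hnd
  have hn0 : 0 < n := by linarith
  have hk : 0 < 1 / √n := by positivity
  have hk2 : (1 / √n) ^ 2 = 1 / n := by rw [div_pow, Real.sq_sqrt hn0.le, one_pow]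
  refine ⟨Gf (Th (1 / √n) α), adm_Gf (Th_smooth _ hα) (Th_zero _ hα), ?_, ?_⟩
  · rw [norm_scale, ← hnd, hk2]; field_simp
  · refine (kin_up hk hα (by linarith)).trans ?_
    rw [hk2, mul_assoc (4 * π * α)]
    refine mul_le_mul_of_nonneg_left ?_ (by have := pi_pos; positivity)
    rw [one_div_mul_eq_div, div_le_iff₀ hn0]
    nlinarith

/-- Two-anyon energy asymptotics: there exist `C > 0` and `α₀ ∈ (0,1]` such
that for every `α ∈ (0, α₀]`, `|E^N_2(α) − 4πα| ≤ C α^{4/3}`. -/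
theorem two_anyon_energy_asymptotics :
    ∃ C α₀ : ℝ, 0 < C ∧ α₀ ∈ Set.Ioc (0 : ℝ) 1 ∧ ∀ α ∈ Set.Ioc (0 : ℝ) α₀,
      |EN 2 α - 4 * π * α| ≤ C * α ^ ((4 : ℝ) / 3) := by
  refine ⟨1000, 1 / 1000, by norm_num, by norm_num, ?_⟩
  rintro α ⟨hα, hα1⟩
  have hpi := pi_pos
  have hpi4 := pi_lt_d2
  set a := α ^ ((1:ℝ) / 3) with had
  have ha : 0 < a := Real.rpow_pos_of_pos hα _
  have ha3 : a ^ 3 = α := by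
    rw [had, ← Real.rpow_natCast, ← Real.rpow_mul hα.le]; norm_num
  have ha4 : α ^ ((4:ℝ) / 3) = a ^ 4 := by
    rw [had, ← Real.rpow_natCast, ← Real.rpow_mul hα.le]; norm_num
  have ha1 : a ≤ 1 / 10 := by
    by_contra hcon
    push Not at hcon
    have : (1 / 10 : ℝ) ^ 3 < a ^ 3 := by gcongr
    rw [ha3] at this
    norm_num at this
    linarith
  obtain ⟨Ψ, h1, h2, h3⟩ := upper hα hα1
  have hlow : ∀ E ∈ {E | ∃ Ψ : Config 2 → ℂ, Admissible 2 Ψ ∧ normSq 2 Q0 Ψ = 1 ∧ E = kinE 2 α Q0 Ψ},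
      4 * π * a ^ 3 * (1 - 60 * a) ≤ E := by
    rintro E ⟨Φ, k1, k2, rfl⟩
    have := lower k1 k2 ha ha1
    rwa [ha3] at this ⊢
  have u : EN 2 α ≤ 4 * π * α * (1 + 100 * α) := by
    refine le_trans ?_ h3
    unfold EN neumannE
    rw [if_neg (by norm_num)]
    exact csInf_le ⟨_, hlow⟩ ⟨Ψ, h1, h2, rfl⟩
  have l : 4 * π * a ^ 3 * (1 - 60 * a) ≤ EN 2 α := by
    unfold EN neumannE
    rw [if_neg (by norm_num)]
    exact le_csInf ⟨_, Ψ, h1, h2, rfl⟩ hlow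
  rw [ha4, ← ha3, abs_le]
  rw [← ha3] at u l
  have q4 : 0 ≤ a ^ 4 := by positivity
  have q1 : π * a ^ 4 ≤ 3.15 * a ^ 4 := mul_le_mul_of_nonneg_right hpi4.le q4
  have q2 : a ^ 6 ≤ a ^ 4 * (1 / 100) := by
    have : a ^ 2 ≤ 1 / 100 := by nlinarith
    calc a ^ 6 = a ^ 4 * a ^ 2 := by ring
      _ ≤ _ := mul_le_mul_of_nonneg_left this q4
  have q3 : π * a ^ 6 ≤ π * (a ^ 4 * (1 / 100)) := mul_le_mul_of_nonneg_left q2 hpi.le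
  constructor
  · nlinarith only [l, q1, q4]
  · nlinarith only [u, q1, q3, q4]
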